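/- arXiv:2302.02640 — 2 statements merged into one kernel-verified Lean document; each statement's English description precedes it below -/
import Mathlib

section
/- The family (𝒲_α)_{α∈Λ} of Arar–Boulmezaoud functions is, after normalization, a Hilbert basis of W¹₀(ℝ³) endowed with the inner product ((v,w)) = ∫_{ℝ³} ∇v·∇w dx: the functions 𝒲_α are pairwise orthogonal in this inner product, each has nonzero norm, and the closure of their linear span is all of W¹₀(ℝ³); consequently every U ∈ W¹₀(ℝ³) satisfies U = Σ_{k=0}^{∞} (4/((2k+1)(2k+3))) Σ_{α∈Λ_k} (∫_{ℝ³} ∇U·∇𝒲_α dx) 𝒲_α, with convergence in W¹₀(ℝ³). -/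
open MeasureTheory Real Filter Metric
open scoped RealInnerProductSpace BigOperators

noncomputable section

abbrev E3 := EuclideanSpace ℝ (Fin 3)
abbrev E4 := EuclideanSpace ℝ (Fin 4)

/-- The index set `Λ = {(k,ℓ,m) : ℓ ≤ k, |m| ≤ ℓ}`. -/
def memLam (α : ℕ × ℕ × ℤ) : Prop := α.2.1 ≤ α.1 ∧ α.2.2.natAbs ≤ α.2.1

/-- `Λ_k` as a finite set. -/
def LamK (k : ℕ) : Finset (ℕ × ℕ × ℤ) :=
  (Finset.range (k+1)).biUnion fun l => (Finset.Icc (-(l:ℤ)) (l:ℤ)).image fun m => (k, l, m)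

/-- `Λ*_N = ∪_{k ≤ N} Λ_k`. -/
def LamStar (N : ℕ) : Finset (ℕ × ℕ × ℤ) := (Finset.range (N+1)).biUnion LamK

/-- Associated Legendre function `P_ℓ^m(t) = ((-1)^m/(2^ℓ ℓ!)) (1-t²)^{m/2} (d/dt)^{ℓ+m}(t²-1)^ℓ`. -/
def legendreP (l m : ℕ) (t : ℝ) : ℝ :=
  ((-1:ℝ)^m / (2^l * (Nat.factorial l))) * (Real.sqrt (1 - t^2))^m *
    (Polynomial.derivative^[l+m] ((Polynomial.X^2 - 1 : Polynomial ℝ)^l)).eval t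

/-- Normalized associated Legendre function `K_ℓ^m = (-1)^m √((ℓ-m)!/(ℓ+m)!) P_ℓ^m`. -/
def Kfun (l m : ℕ) (t : ℝ) : ℝ :=
  (-1:ℝ)^m * Real.sqrt ((Nat.factorial (l-m)) / (Nat.factorial (l+m))) * legendreP l m t

/-- The angular factor `y_m`. -/
def ymfun (m : ℤ) (φ : ℝ) : ℝ :=
  if m = 0 then 1 / Real.sqrt 2
  else if 0 < m then Real.cos (m * φ)
  else Real.sin (|m| * φ)

/-- Real spherical harmonics `Y_{ℓ,m}` on `S²`. -/
def Y2fun (l : ℕ) (m : ℤ) (φ θ : ℝ) : ℝ :=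
  Real.sqrt ((2*l+1)/(2*π)) * Kfun l m.natAbs (Real.cos θ) * ymfun m φ

/-- Normalization constants `a_{k,ℓ} = ((k+1)π/2)·(k+ℓ+1)!/(k-ℓ)!`. -/
def akl (k l : ℕ) : ℝ :=
  ((k+1) * π / 2) * (Nat.factorial (k+l+1)) / (Nat.factorial (k-l))

/-- `d`-th derivative of the Chebyshev polynomial of the first kind `T_n`, evaluated at `t`. -/
def chebDeriv (n d : ℕ) (t : ℝ) : ℝ :=
  (Polynomial.derivative^[d] (Polynomial.Chebyshev.T ℝ (n : ℤ))).eval t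

/-- Spherical harmonic `𝒴_α` on `S³`, as a function of the spherical coordinates `(φ,θ,χ)`:
`𝒴_α = a_{k,ℓ}^{-1/2} (sin χ)^ℓ T_{k+1}^{(ℓ+1)}(cos χ) Y_{ℓ,m}(φ,θ)`. -/
def Yfun (α : ℕ × ℕ × ℤ) (φ θ χ : ℝ) : ℝ :=
  (1 / Real.sqrt (akl α.1 α.2.1)) * (Real.sin χ)^α.2.1 *
    chebDeriv (α.1+1) (α.2.1+1) (Real.cos χ) * Y2fun α.2.1 α.2.2 φ θ

/-- The azimuthal spherical coordinate `φ` of `π⁻¹(x)`. -/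
def sphPhi (x : E3) : ℝ := Complex.arg ⟨x 0, x 1⟩

/-- The polar spherical coordinate `θ` of `π⁻¹(x)`, i.e. `cos θ = x₃/|x|`. -/
def sphTheta (x : E3) : ℝ := Real.arccos (x 2 / ‖x‖)

/-- The spherical coordinate `χ` of `π⁻¹(x)`, i.e. `cos χ = (|x|²-1)/(|x|²+1)`. -/
def sphChi (x : E3) : ℝ := Real.arccos ((‖x‖^2 - 1) / (‖x‖^2 + 1))

/-- The Arar–Boulmezaoud function `𝒲_α(x) = (2/(|x|²+1))^{1/2} 𝒴_α(π⁻¹(x))`. -/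
def Wfun (α : ℕ × ℕ × ℤ) (x : E3) : ℝ :=
  Real.sqrt (2 / (‖x‖^2 + 1)) * Yfun α (sphPhi x) (sphTheta x) (sphChi x)

/-- Partial derivative in the `i`-th coordinate direction. -/
def pd3 (i : Fin 3) (f : E3 → ℝ) (x : E3) : ℝ := fderiv ℝ f x (EuclideanSpace.single i 1)

/-- `g` is the distributional (weak) gradient of `v` on `ℝ³`. -/
def IsWeakGradient (v : E3 → ℝ) (g : E3 → E3) : Prop :=
  ∀ φ : E3 → ℝ, ContDiff ℝ (⊤ : ℕ∞) φ → HasCompactSupport φ →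
    ∀ i : Fin 3, ∫ x : E3, v x * pd3 i φ x = - ∫ x : E3, g x i * φ x

/-- Membership in the weighted Sobolev space `W¹₀(ℝ³)`:
`v` is locally integrable, `(1+|x|²)^{-1/2} v ∈ L²(ℝ³)`, and the distributional
gradient `g` of `v` belongs to `L²(ℝ³)³`. -/
def MemW10 (v : E3 → ℝ) (g : E3 → E3) : Prop :=
  MeasureTheory.LocallyIntegrable v volume ∧
  MeasureTheory.Integrable (fun x : E3 => (v x)^2 / (1 + ‖x‖^2)) volume ∧
  MeasureTheory.AEStronglyMeasurable g volume ∧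
  IsWeakGradient v g ∧
  MeasureTheory.Integrable (fun x : E3 => ‖g x‖^2) volume

/-! ### Gegenbauer-type equations and weighted moments -/

/-- The equation `(1 - t²) p'' - c t p' + e p = 0`. -/
def GegenbauerEq (c e : ℝ) (p : Polynomial ℝ) : Prop :=
  ∀ t : ℝ, (1 - t ^ 2) * p.derivative.derivative.eval t - c * t * p.derivative.eval t
    + e * p.eval t = 0

theorem GegenbauerEq.derivative {c e : ℝ} {p : Polynomial ℝ} (h : GegenbauerEq c e p) :
    GegenbauerEq (c + 2) (e - c) p.derivative := by
  have hp : (1 - Polynomial.X ^ 2) * p.derivative.derivative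
      - Polynomial.C c * Polynomial.X * p.derivative + Polynomial.C e * p = 0 :=
    Polynomial.funext fun t => by simpa using h t
  intro t
  have := congrArg (fun q => (Polynomial.derivative q).eval t) hp
  simp at this
  linear_combination this

/-- The moment `∫₀^π (sin θ)^s p(cos θ) q(cos θ) dθ`. -/
def trigMoment (s : ℕ) (p q : Polynomial ℝ) : ℝ :=
  ∫ θ in (0 : ℝ)..π, sin θ ^ s * (p.eval (cos θ) * q.eval (cos θ))

theorem trigMoment_comm (s : ℕ) (p q : Polynomial ℝ) : trigMoment s p q = trigMoment s q p := by
  simp only [trigMoment, mul_comm]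

theorem hasDerivAt_eval_cos (p : Polynomial ℝ) (θ : ℝ) :
    HasDerivAt (fun θ => p.eval (cos θ)) (p.derivative.eval (cos θ) * (-sin θ)) θ :=
  (p.hasDerivAt (cos θ)).comp θ (hasDerivAt_cos θ)

theorem continuous_eval_cos (p : Polynomial ℝ) : Continuous fun θ => p.eval (cos θ) :=
  p.continuous.comp continuous_cos

theorem trigMoment_derivative {s : ℕ} {e : ℝ} {p : Polynomial ℝ} (h : GegenbauerEq (s + 1) e p)
    (q : Polynomial ℝ) :
    trigMoment (s + 2) p.derivative q.derivative = e * trigMoment s p q := by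
  have key : ∀ θ : ℝ, HasDerivAt
      (fun θ => sin θ ^ (s + 1) * (p.derivative.eval (cos θ) * q.eval (cos θ)))
      (e * (sin θ ^ s * (p.eval (cos θ) * q.eval (cos θ)))
        - sin θ ^ (s + 2) * (p.derivative.eval (cos θ) * q.derivative.eval (cos θ))) θ := by
    intro θ
    have h1 := ((hasDerivAt_sin θ).pow (s + 1)).mul
      ((hasDerivAt_eval_cos p.derivative θ).mul (hasDerivAt_eval_cos q θ))
    refine h1.congr_deriv ?_
    have h2 := h (cos θ)
    have h3 := sin_sq_add_cos_sq θ
    simp only [Pi.mul_apply, Pi.pow_apply, Nat.add_sub_cancel, Nat.cast_add, Nat.cast_one]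
    linear_combination (-(sin θ ^ s * q.eval (cos θ))) * h2 -
      (sin θ ^ s * q.eval (cos θ) * p.derivative.derivative.eval (cos θ)) * h3
  have hc1 : Continuous fun θ => sin θ ^ s * (p.eval (cos θ) * q.eval (cos θ)) :=
    (continuous_sin.pow s).mul ((continuous_eval_cos p).mul (continuous_eval_cos q))
  have hc2 : Continuous fun θ =>
      sin θ ^ (s + 2) * (p.derivative.eval (cos θ) * q.derivative.eval (cos θ)) :=
    (continuous_sin.pow _).mul ((continuous_eval_cos _).mul (continuous_eval_cos _))
  have hc3 : Continuous fun θ => e * (sin θ ^ s * (p.eval (cos θ) * q.eval (cos θ))) :=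
    continuous_const.mul hc1
  have := intervalIntegral.integral_eq_sub_of_hasDerivAt (a := 0) (b := π) (fun θ _ => key θ)
    ((hc3.sub hc2).intervalIntegrable _ _)
  rw [intervalIntegral.integral_sub (hc3.intervalIntegrable _ _)
    (hc2.intervalIntegrable _ _), intervalIntegral.integral_const_mul] at this
  simp only [sin_pi, sin_zero, ne_eq, Nat.add_eq_zero_iff, one_ne_zero, and_false,
    not_false_eq_true, zero_pow, zero_mul, sub_zero] at this
  simp only [trigMoment]
  linarith

theorem trigMoment_eq_zero {s : ℕ} {e e' : ℝ} {p q : Polynomial ℝ}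
    (hp : GegenbauerEq (s + 1) e p) (hq : GegenbauerEq (s + 1) e' q) (hne : e ≠ e') :
    trigMoment s p q = 0 := by
  have h1 := trigMoment_derivative hp q
  have h2 := trigMoment_derivative hq p
  rw [trigMoment_comm, trigMoment_comm s q p] at h2
  have : (e - e') * trigMoment s p q = 0 := by linear_combination h2 - h1
  exact (mul_eq_zero.mp this).resolve_left (sub_ne_zero.mpr hne)

/-! ### Chebyshev moments -/

/-- The `d`-th derivative of the Chebyshev polynomial `T_n`. -/
def chebPoly (n d : ℕ) : Polynomial ℝ :=
  Polynomial.derivative^[d] (Polynomial.Chebyshev.T ℝ (n : ℤ))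

theorem chebPoly_succ (n d : ℕ) : chebPoly n (d + 1) = (chebPoly n d).derivative :=
  Function.iterate_succ_apply' _ _ _

theorem chebPoly_gegenbauer (n d : ℕ) :
    GegenbauerEq (2 * d + 1) ((n : ℝ) ^ 2 - d ^ 2) (chebPoly n d) := by
  intro t
  have := Polynomial.Chebyshev.one_sub_X_sq_mul_iterate_derivative_T_eval (R := ℝ) n d t
  rw [← chebPoly_succ, ← chebPoly_succ]
  simp only [chebPoly]
  push_cast at this
  linear_combination this

theorem trigMoment_chebPoly_self_zero {n : ℕ} (hn : n ≠ 0) :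
    trigMoment 0 (chebPoly n 0) (chebPoly n 0) = π / 2 := by
  have hn' : (n : ℝ) ≠ 0 := Nat.cast_ne_zero.mpr hn
  have : ∀ θ : ℝ, sin θ ^ 0 * ((chebPoly n 0).eval (cos θ) * (chebPoly n 0).eval (cos θ))
      = cos (n * θ) ^ 2 := by
    intro θ
    simp only [chebPoly, Function.iterate_zero, id, Polynomial.Chebyshev.T_real_cos]
    push_cast
    ring
  simp only [trigMoment, this]
  rw [intervalIntegral.integral_comp_mul_left (fun x => cos x ^ 2) hn', integral_cos_sq]
  simp only [mul_zero, sin_nat_mul_pi, sin_zero, smul_eq_mul]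
  field_simp
  ring

theorem trigMoment_chebPoly_self {k d : ℕ} (h : d ≤ k + 1) :
    trigMoment (2 * d) (chebPoly (k + 1) d) (chebPoly (k + 1) d)
      * (Nat.factorial (k + 1 - d)) * (k + 1 + d)
      = (k + 1) * π / 2 * (Nat.factorial (k + 1 + d)) := by
  induction d with
  | zero =>
    rw [trigMoment_chebPoly_self_zero (Nat.succ_ne_zero k)]
    simp
    ring
  | succ d ih =>
    have hg : GegenbauerEq ((2 * d : ℕ) + 1) (((k + 1 : ℕ) : ℝ) ^ 2 - d ^ 2)
        (chebPoly (k + 1) d) := by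
      have := chebPoly_gegenbauer (k + 1) d
      push_cast at this ⊢
      exact this
    have h1 := trigMoment_derivative hg (chebPoly (k + 1) d)
    rw [← chebPoly_succ] at h1
    have ih := ih (by omega)
    obtain ⟨j, rfl⟩ : ∃ j, k = d + j := ⟨k - d, by omega⟩
    rw [show 2 * (d + 1) = 2 * d + 2 by ring, h1]
    rw [show d + j + 1 - d = j + 1 by omega, Nat.factorial_succ] at ih
    rw [show d + j + 1 - (d + 1) = j by omega,
      show d + j + 1 + (d + 1) = (d + j + 1 + d) + 1 by ring, Nat.factorial_succ]
    push_cast at ih ⊢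
    linear_combination (d + j + 1 + d + 1 : ℝ) * ih

theorem trigMoment_chebPoly_akl {k l : ℕ} (h : l ≤ k) :
    trigMoment (2 * l + 2) (chebPoly (k + 1) (l + 1)) (chebPoly (k + 1) (l + 1)) = akl k l := by
  have h1 := trigMoment_chebPoly_self (k := k) (d := l + 1) (by omega)
  rw [show k + 1 - (l + 1) = k - l by omega, show k + 1 + (l + 1) = (k + l + 1) + 1 by ring,
    Nat.factorial_succ, show 2 * (l + 1) = 2 * l + 2 by ring] at h1
  have h2 : ((Nat.factorial (k - l) : ℕ) : ℝ) ≠ 0 := by positivity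
  have h3 : ((k : ℝ) + l + 1 + 1) ≠ 0 := by positivity
  rw [akl, eq_div_iff h2]
  push_cast at h1
  refine mul_right_cancel₀ h3 ?_
  linear_combination h1

theorem trigMoment_chebPoly_of_ne {k k' l : ℕ} (h : k ≠ k') :
    trigMoment (2 * l + 2) (chebPoly (k + 1) (l + 1)) (chebPoly (k' + 1) (l + 1)) = 0 := by
  have hg : ∀ k : ℕ, GegenbauerEq ((2 * l + 2 : ℕ) + 1)
      (((k + 1 : ℕ) : ℝ) ^ 2 - ((l + 1 : ℕ) : ℝ) ^ 2) (chebPoly (k + 1) (l + 1)) := by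
    intro k
    have := chebPoly_gegenbauer (k + 1) (l + 1)
    rwa [show (2 * ((l + 1 : ℕ) : ℝ) + 1) = ((2 * l + 2 : ℕ) : ℝ) + 1 by push_cast; ring] at this
  refine trigMoment_eq_zero (hg k) (hg k') ?_
  intro h'
  have h2 : ((k + 1 : ℕ) : ℝ) ^ 2 = ((k' + 1 : ℕ) : ℝ) ^ 2 := by linear_combination h'
  have h3 := (pow_left_inj₀ (Nat.cast_nonneg _) (Nat.cast_nonneg _) two_ne_zero).mp h2
  have := Nat.cast_injective h3
  omega

/-! ### Legendre moments -/

/-- The polynomial `(d/dt)^{l+m} (t² - 1)^l`. -/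
def legPoly (l m : ℕ) : Polynomial ℝ :=
  Polynomial.derivative^[l + m] ((Polynomial.X ^ 2 - 1 : Polynomial ℝ) ^ l)

theorem legPoly_succ (l m : ℕ) : legPoly l (m + 1) = (legPoly l m).derivative :=
  Function.iterate_succ_apply' _ _ _

theorem iterate_derivative_rodrigues_gegenbauer (l j : ℕ) :
    GegenbauerEq (2 * j - (2 * l - 2)) (2 * l + j * (2 * l - 1 - j))
      (Polynomial.derivative^[j] ((Polynomial.X ^ 2 - 1 : Polynomial ℝ) ^ l)) := by
  induction j with
  | zero =>
    intro t
    rcases l with _ | _ | l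
    · simp
    · simp
      ring
    · simp [Polynomial.derivative_pow]
      ring
  | succ j ih =>
    rw [Function.iterate_succ_apply']
    convert ih.derivative using 1 <;> push_cast <;> ring

theorem legPoly_gegenbauer (l m : ℕ) :
    GegenbauerEq (2 * m + 2) (((l : ℝ) - m) * (l + m + 1)) (legPoly l m) := by
  have := iterate_derivative_rodrigues_gegenbauer l (l + m)
  unfold legPoly
  convert this using 1 <;> push_cast <;> ring

theorem trigMoment_legPoly_of_ne {l l' m : ℕ} (h : l ≠ l') :
    trigMoment (2 * m + 1) (legPoly l m) (legPoly l' m) = 0 := by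
  have hg : ∀ l : ℕ, GegenbauerEq ((2 * m + 1 : ℕ) + 1) (((l : ℝ) - m) * (l + m + 1))
      (legPoly l m) := by
    intro l
    have := legPoly_gegenbauer l m
    rwa [show (2 * (m : ℝ) + 2) = ((2 * m + 1 : ℕ) : ℝ) + 1 by push_cast; ring] at this
  refine trigMoment_eq_zero (hg l) (hg l') ?_
  intro h'
  have h2 : ((l : ℝ) - l') * (l + l' + 1) = 0 := by linear_combination h'
  rcases mul_eq_zero.mp h2 with h3 | h3
  · exact h (Nat.cast_injective (sub_eq_zero.mp h3))
  · have : (0 : ℝ) < l + l' + 1 := by positivity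
    exact this.ne' h3

theorem eval_iterate_derivative_rodrigues {l j : ℕ} (hj : j < l) {t : ℝ} (ht : t ^ 2 = 1) :
    (Polynomial.derivative^[j] ((Polynomial.X ^ 2 - 1 : Polynomial ℝ) ^ l)).eval t = 0 := by
  obtain ⟨r, hr⟩ := Polynomial.pow_sub_dvd_iterate_derivative_pow
    (Polynomial.X ^ 2 - 1 : Polynomial ℝ) l j
  rw [hr, Polynomial.eval_mul, Polynomial.eval_pow]
  have : l - j ≠ 0 := by omega
  simp [ht, this]

theorem trigMoment_rodrigues {l j : ℕ} (hj : j ≤ l) (g : Polynomial ℝ) :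
    trigMoment 1 (Polynomial.derivative^[j] ((Polynomial.X ^ 2 - 1 : Polynomial ℝ) ^ l)) g
      = (-1) ^ j * trigMoment 1 ((Polynomial.X ^ 2 - 1 : Polynomial ℝ) ^ l)
        (Polynomial.derivative^[j] g) := by
  induction j generalizing g with
  | zero => simp
  | succ j ih =>
    set p := Polynomial.derivative^[j] ((Polynomial.X ^ 2 - 1 : Polynomial ℝ) ^ l) with hp
    have key : ∀ θ : ℝ, HasDerivAt (fun θ => p.eval (cos θ) * g.eval (cos θ))
        (-(sin θ ^ 1 * (p.derivative.eval (cos θ) * g.eval (cos θ)))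
          - sin θ ^ 1 * (p.eval (cos θ) * g.derivative.eval (cos θ))) θ := by
      intro θ
      refine ((hasDerivAt_eval_cos p θ).mul (hasDerivAt_eval_cos g θ)).congr_deriv ?_
      ring
    have hc : ∀ p q : Polynomial ℝ,
        Continuous fun θ => sin θ ^ 1 * (p.eval (cos θ) * q.eval (cos θ)) := fun p q =>
      (continuous_sin.pow 1).mul ((continuous_eval_cos p).mul (continuous_eval_cos q))
    have hn : Continuous fun θ => -(sin θ ^ 1 * (p.derivative.eval (cos θ) * g.eval (cos θ))) :=
      (hc _ _).neg
    have := intervalIntegral.integral_eq_sub_of_hasDerivAt (a := 0) (b := π) (fun θ _ => key θ)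
      ((hn.sub (hc _ _)).intervalIntegrable _ _)
    rw [intervalIntegral.integral_sub (hn.intervalIntegrable _ _)
      ((hc _ _).intervalIntegrable _ _), intervalIntegral.integral_neg, cos_pi, cos_zero,
      hp, eval_iterate_derivative_rodrigues (by omega) (by norm_num),
      eval_iterate_derivative_rodrigues (by omega) (by norm_num), ← hp] at this
    have h2 := ih (by omega) g.derivative
    rw [Function.iterate_succ_apply', Function.iterate_succ_apply, ← hp]
    simp only [trigMoment] at this h2 ⊢
    rw [pow_succ]
    linear_combination (-1 : ℝ) * this - h2

theorem trigMoment_legPoly_self_zero (l : ℕ) :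
    trigMoment 1 (legPoly l 0) (legPoly l 0) * (2 * l + 1)
      = 2 * ((2 : ℝ) ^ l * Nat.factorial l) ^ 2 := by
  have hdeg : (Polynomial.X ^ 2 - 1 : Polynomial ℝ).natDegree = 2 := by compute_degree!
  have hmon : (Polynomial.X ^ 2 - 1 : Polynomial ℝ).Monic := by monicity!
  have htop : Polynomial.derivative^[l] (legPoly l 0)
      = Polynomial.C ((Nat.factorial (2 * l) : ℕ) : ℝ) := by
    have hd : ((Polynomial.X ^ 2 - 1 : Polynomial ℝ) ^ l).natDegree = 2 * l := by
      rw [Polynomial.natDegree_pow, hdeg, mul_comm]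
    have h0 : (Polynomial.derivative^[2 * l]
        ((Polynomial.X ^ 2 - 1 : Polynomial ℝ) ^ l)).natDegree = 0 := by
      have := Polynomial.natDegree_iterate_derivative
        ((Polynomial.X ^ 2 - 1 : Polynomial ℝ) ^ l) (2 * l)
      omega
    rw [legPoly, add_zero, ← Function.iterate_add_apply, ← two_mul,
      Polynomial.eq_C_of_natDegree_eq_zero h0, Polynomial.coeff_iterate_derivative, zero_add,
      ← hd, (hmon.pow l).coeff_natDegree, Nat.descFactorial_self]
    simp
  have h1 := trigMoment_rodrigues (le_refl l) (legPoly l 0)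
  rw [htop] at h1
  have h2 : trigMoment 1 (legPoly l 0) (legPoly l 0)
      = Nat.factorial (2 * l) * ∫ θ in (0 : ℝ)..π, sin θ ^ (2 * l + 1) := by
    rw [← intervalIntegral.integral_const_mul]
    refine Eq.trans h1 ?_
    rw [trigMoment, ← intervalIntegral.integral_const_mul]
    congr 1
    ext θ
    have : cos θ ^ 2 - 1 = - sin θ ^ 2 := by linarith [sin_sq_add_cos_sq θ]
    simp only [Polynomial.eval_pow, Polynomial.eval_sub, Polynomial.eval_X, Polynomial.eval_one,
      Polynomial.eval_C, this]
    rw [neg_pow, pow_succ (sin θ) (2 * l), pow_mul (sin θ)]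
    have : ((-1 : ℝ) ^ l) * (-1) ^ l = 1 := by rw [← mul_pow]; simp
    linear_combination (sin θ * (sin θ ^ 2) ^ l * (Nat.factorial (2 * l))) * this
  have h3 : ∀ n : ℕ, ((Nat.factorial (2 * n) : ℕ) : ℝ) *
      (∏ i ∈ Finset.range n, (2 * (i : ℝ) + 2) / (2 * i + 3)) * (2 * n + 1)
      = ((2 : ℝ) ^ n * Nat.factorial n) ^ 2 := by
    intro n
    induction n with
    | zero => simp
    | succ n ih =>
      rw [Finset.prod_range_succ, show 2 * (n + 1) = 2 * n + 1 + 1 by ring, Nat.factorial_succ,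
        Nat.factorial_succ, Nat.factorial_succ]
      push_cast
      have hdiv : (2 * (n : ℝ) + 2) / (2 * n + 3) * (2 * n + 3) = 2 * n + 2 :=
        div_mul_cancel₀ _ (by positivity)
      generalize (∏ i ∈ Finset.range n, (2 * (i : ℝ) + 2) / (2 * i + 3)) = P at ih ⊢
      linear_combination (2 * (n : ℝ) + 2) ^ 2 * ih
        + (2 * (n : ℝ) + 2) * (2 * n + 1) * (Nat.factorial (2 * n)) * P * hdiv
  rw [h2, integral_sin_pow_odd]
  linear_combination 2 * h3 l

theorem trigMoment_legPoly_self {l m : ℕ} (h : m ≤ l) :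
    trigMoment (2 * m + 1) (legPoly l m) (legPoly l m) * (2 * l + 1) * Nat.factorial (l - m)
      = 2 * ((2 : ℝ) ^ l * Nat.factorial l) ^ 2 * Nat.factorial (l + m) := by
  induction m with
  | zero =>
    simp only [mul_zero, zero_add, Nat.sub_zero, add_zero]
    rw [trigMoment_legPoly_self_zero]
  | succ m ih =>
    have hg : GegenbauerEq ((2 * m + 1 : ℕ) + 1) (((l : ℝ) - m) * (l + m + 1)) (legPoly l m) := by
      have := legPoly_gegenbauer l m
      rwa [show (2 * (m : ℝ) + 2) = ((2 * m + 1 : ℕ) : ℝ) + 1 by push_cast; ring] at this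
    have h1 := trigMoment_derivative hg (legPoly l m)
    rw [← legPoly_succ] at h1
    have ih := ih (by omega)
    obtain ⟨j, rfl⟩ : ∃ j, l = m + 1 + j := ⟨l - (m + 1), by omega⟩
    rw [show 2 * (m + 1) + 1 = 2 * m + 1 + 2 by ring, h1]
    rw [show m + 1 + j - m = j + 1 by omega, Nat.factorial_succ j] at ih
    rw [show m + 1 + j - (m + 1) = j by omega, ← add_assoc (m + 1 + j) m 1,
      Nat.factorial_succ (m + 1 + j + m)]
    push_cast at ih ⊢
    linear_combination (m + 1 + j + m + 1 : ℝ) * ih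

/-! ### Azimuthal moments -/

theorem integral_cos_int_mul {n : ℤ} (hn : n ≠ 0) : ∫ φ in -π..π, cos (n * φ) = 0 := by
  rw [intervalIntegral.integral_comp_mul_left cos (Int.cast_ne_zero.mpr hn), integral_cos]
  simp

theorem integral_odd_symm {f : ℝ → ℝ} (hf : ∀ x, f (-x) = -f x) (a : ℝ) :
    ∫ x in -a..a, f x = 0 := by
  have h := intervalIntegral.integral_comp_neg (a := -a) (b := a) f
  simp only [hf, intervalIntegral.integral_neg, neg_neg] at h
  linarith

theorem integral_ymfun_mul (m m' : ℤ) :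
    ∫ φ in -π..π, ymfun m φ * ymfun m' φ = if m = m' then π else 0 := by
  have hcos : ∀ n : ℤ, IntervalIntegrable (fun φ : ℝ => cos (n * φ)) volume (-π) π := fun n =>
    (by fun_prop : Continuous fun φ : ℝ => cos (n * φ)).intervalIntegrable _ _
  have hintg : ∀ n : ℤ, ∫ φ in -π..π, cos (n * φ) = if n = 0 then 2 * π else 0 := by
    intro n
    split_ifs with h
    · simp [h]; ring
    · exact integral_cos_int_mul h
  have hcc : ∀ a b : ℤ, ∫ φ in -π..π, cos (a * φ) * cos (b * φ)
      = ((if a - b = 0 then 2 * π else 0) + (if a + b = 0 then 2 * π else 0)) / 2 := by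
    intro a b
    rw [← hintg, ← hintg, ← intervalIntegral.integral_add (hcos _) (hcos _),
      ← intervalIntegral.integral_div]
    congr 1; ext φ
    push_cast
    rw [sub_mul, add_mul, cos_sub, cos_add]; ring
  have hss : ∀ a b : ℤ, ∫ φ in -π..π, sin (a * φ) * sin (b * φ)
      = ((if a - b = 0 then 2 * π else 0) - (if a + b = 0 then 2 * π else 0)) / 2 := by
    intro a b
    rw [← hintg, ← hintg, ← intervalIntegral.integral_sub (hcos _) (hcos _),
      ← intervalIntegral.integral_div]
    congr 1; ext φ
    push_cast
    rw [sub_mul, add_mul, cos_sub, cos_add]; ring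
  have hsc : ∀ a b : ℤ, ∫ φ in -π..π, sin (a * φ) * cos (b * φ) = 0 := by
    intro a b
    refine integral_odd_symm (fun x => ?_) π
    simp
  have hcs : ∀ a b : ℤ, ∫ φ in -π..π, cos (a * φ) * sin (b * φ) = 0 := by
    intro a b
    refine integral_odd_symm (fun x => ?_) π
    simp
  have hsqrt : (1 / √2 : ℝ) * (1 / √2) = 1 / 2 := by
    rw [div_mul_div_comm, Real.mul_self_sqrt (by norm_num)]; norm_num
  rcases lt_trichotomy m 0 with hm | hm | hm <;> rcases lt_trichotomy m' 0 with hm' | hm' | hm'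
  · simp only [ymfun, hm.ne, hm'.ne, hm.not_gt, hm'.not_gt, if_false, hss]
    rw [abs_of_neg hm, abs_of_neg hm']
    split_ifs <;> first | omega | ring
  · subst hm'
    simp only [ymfun, hm.ne, hm.not_gt, if_false, if_true]
    have := hsc |m| 0
    simp only [Int.cast_zero, zero_mul, cos_zero, mul_one] at this
    rw [intervalIntegral.integral_mul_const, this, zero_mul]
  · simp only [ymfun, hm.ne, hm'.ne', hm.not_gt, hm', if_false, if_true, hsc]
    split_ifs <;> first | omega | ring
  · subst hm
    simp only [ymfun, hm'.ne, hm'.not_gt, if_false, if_true]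
    have := hsc |m'| 0
    simp only [Int.cast_zero, zero_mul, cos_zero, mul_one] at this
    rw [intervalIntegral.integral_const_mul, this, mul_zero, if_neg hm'.ne']
  · subst hm; subst hm'
    simp only [ymfun, if_true, hsqrt, intervalIntegral.integral_const, smul_eq_mul]
    ring
  · subst hm
    simp only [ymfun, hm', hm'.ne', if_false, if_true]
    rw [intervalIntegral.integral_const_mul, integral_cos_int_mul hm'.ne', mul_zero,
      if_neg hm'.ne]
  · simp only [ymfun, hm.ne', hm'.ne, hm'.not_gt, hm, if_false, if_true, hcs]
    split_ifs <;> first | omega | ring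
  · subst hm'
    simp only [ymfun, hm, hm.ne', if_false, if_true]
    rw [intervalIntegral.integral_mul_const, integral_cos_int_mul hm.ne', zero_mul]
  · simp only [ymfun, hm, hm', hm.ne', hm'.ne', if_false, if_true, hcc]
    split_ifs <;> first | omega | ring

/-! ### Solid harmonics -/

theorem natDegree_rodrigues (l : ℕ) : ((Polynomial.X ^ 2 - 1 : Polynomial ℝ) ^ l).natDegree
    = 2 * l := by
  have hdeg : (Polynomial.X ^ 2 - 1 : Polynomial ℝ).natDegree = 2 := by compute_degree!
  rw [Polynomial.natDegree_pow, hdeg, mul_comm]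

theorem natDegree_legPoly_le (l m : ℕ) : (legPoly l m).natDegree ≤ l - m := by
  have := Polynomial.natDegree_iterate_derivative
    ((Polynomial.X ^ 2 - 1 : Polynomial ℝ) ^ l) (l + m)
  rw [natDegree_rodrigues] at this
  rw [legPoly]
  omega

theorem coeff_legPoly_top {l m : ℕ} (h : m ≤ l) : (legPoly l m).coeff (l - m) ≠ 0 := by
  have hmon : (Polynomial.X ^ 2 - 1 : Polynomial ℝ).Monic := by monicity!
  have h1 : ((Polynomial.X ^ 2 - 1 : Polynomial ℝ) ^ l).coeff (2 * l) = 1 := by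
    rw [← natDegree_rodrigues]
    exact (hmon.pow l).coeff_natDegree
  rw [legPoly, Polynomial.coeff_iterate_derivative, show l - m + (l + m) = 2 * l by omega, h1]
  have : (2 * l).descFactorial (l + m) ≠ 0 := by
    rw [Ne, Nat.descFactorial_eq_zero_iff_lt]
    omega
  simpa using this

theorem coeff_legPoly_of_odd {l m j : ℕ} (hodd : ¬ 2 ∣ (l - m - j)) :
    (legPoly l m).coeff j = 0 := by
  have h1 : ((Polynomial.X ^ 2 - 1 : Polynomial ℝ) ^ l)
      = Polynomial.expand ℝ 2 ((Polynomial.X - 1) ^ l) := by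
    simp
  rw [legPoly, Polynomial.coeff_iterate_derivative, h1, Polynomial.coeff_expand (by norm_num),
    if_neg (by omega), smul_zero]

/-- The homogenization `∑ q_j z^j s^{(d-j)/2}` of a polynomial of degree `d` having the parity
of `d`. -/
def polyHom (d : ℕ) (q : Polynomial ℝ) (z s : ℝ) : ℝ :=
  ∑ j ∈ Finset.range (d + 1), q.coeff j * z ^ j * s ^ ((d - j) / 2)

theorem polyHom_one {d : ℕ} {q : Polynomial ℝ} (hq : q.natDegree ≤ d) (z : ℝ) :
    polyHom d q z 1 = q.eval z := by
  rw [Polynomial.eval_eq_sum_range' (Nat.lt_succ_of_le hq)]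
  simp [polyHom]

theorem polyHom_smul {d : ℕ} {q : Polynomial ℝ}
    (hq : ∀ j ≤ d, ¬ 2 ∣ (d - j) → q.coeff j = 0) (c z s : ℝ) :
    polyHom d q (c * z) (c ^ 2 * s) = c ^ d * polyHom d q z s := by
  rw [polyHom, polyHom, Finset.mul_sum]
  refine Finset.sum_congr rfl fun j hj => ?_
  have hj : j ≤ d := Nat.lt_succ_iff.mp (Finset.mem_range.mp hj)
  by_cases h : 2 ∣ (d - j)
  · obtain ⟨i, hi⟩ := h
    rw [hi, Nat.mul_div_cancel_left _ (by norm_num), show d = j + 2 * i by omega]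
    ring
  · rw [hq j hj h]
    ring

/-- The real or imaginary part of `(a + ib)^|m|`, according to the sign of `m`. -/
def azim (m : ℤ) (a b : ℝ) : ℝ :=
  if m = 0 then 1 / √2
  else if 0 < m then (((a : ℂ) + b * Complex.I) ^ m.natAbs).re
  else (((a : ℂ) + b * Complex.I) ^ m.natAbs).im

theorem azim_polar (m : ℤ) (ρ φ : ℝ) :
    azim m (ρ * cos φ) (ρ * sin φ) = ρ ^ m.natAbs * ymfun m φ := by
  have h : (((ρ * cos φ : ℝ) : ℂ) + ((ρ * sin φ : ℝ) : ℂ) * Complex.I) ^ m.natAbs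
      = ((ρ ^ m.natAbs * cos (m.natAbs * φ) : ℝ) : ℂ)
        + ((ρ ^ m.natAbs * sin (m.natAbs * φ) : ℝ) : ℂ) * Complex.I := by
    have := Complex.cos_add_sin_mul_I_pow m.natAbs φ
    push_cast
    rw [show (ρ : ℂ) * Complex.cos φ + ρ * Complex.sin φ * Complex.I
      = ρ * (Complex.cos φ + Complex.sin φ * Complex.I) by ring, mul_pow, this]
    ring
  have hre : ∀ a b : ℝ, ((a : ℂ) + b * Complex.I).re = a := fun a b => by simp
  have him : ∀ a b : ℝ, ((a : ℂ) + b * Complex.I).im = b := fun a b => by simp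
  rcases lt_trichotomy m 0 with hm | hm | hm
  · simp only [azim, ymfun, hm.ne, hm.not_gt, if_false, h]
    rw [Nat.cast_natAbs, him, Int.cast_abs]
  · simp [hm, azim, ymfun]
  · simp only [azim, ymfun, hm.ne', hm, if_false, if_true, h]
    rw [Nat.cast_natAbs, abs_of_pos hm, hre]

/-- The normalization constant of the solid harmonics. -/
def solidConst (l m : ℕ) : ℝ :=
  √((2 * l + 1) / (2 * π)) * √(Nat.factorial (l - m) / Nat.factorial (l + m))
    / (2 ^ l * Nat.factorial l)

theorem solidConst_pos (l m : ℕ) : 0 < solidConst l m := by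
  have := pi_pos
  unfold solidConst
  positivity

/-- The solid harmonic `|x|^l Y_{l,m}(x/|x|)`, a homogeneous polynomial of degree `l`. -/
def solid (l : ℕ) (m : ℤ) (x : E3) : ℝ :=
  solidConst l m.natAbs * azim m (x 0) (x 1) *
    polyHom (l - m.natAbs) (legPoly l m.natAbs) (x 2) (‖x‖ ^ 2)

theorem E3_norm_sq (x : E3) : ‖x‖ ^ 2 = x 0 ^ 2 + x 1 ^ 2 + x 2 ^ 2 := by
  rw [EuclideanSpace.real_norm_sq_eq, Fin.sum_univ_three]

theorem solid_polar {l : ℕ} {m : ℤ} (hm : m.natAbs ≤ l) {r θ φ : ℝ} {x : E3}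
    (h0 : x 0 = r * sin θ * cos φ) (h1 : x 1 = r * sin θ * sin φ) (h2 : x 2 = r * cos θ) :
    solid l m x = r ^ l * (solidConst l m.natAbs * (sin θ ^ m.natAbs *
      (legPoly l m.natAbs).eval (cos θ)) * ymfun m φ) := by
  have hn : ‖x‖ ^ 2 = r ^ 2 * 1 := by
    rw [E3_norm_sq, h0, h1, h2]
    linear_combination r ^ 2 * sin θ ^ 2 * sin_sq_add_cos_sq φ + r ^ 2 * sin_sq_add_cos_sq θ
  rw [solid, hn, h0, h1, h2, azim_polar,
    polyHom_smul (fun j _ => coeff_legPoly_of_odd), polyHom_one (natDegree_legPoly_le _ _)]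
  obtain ⟨d, rfl⟩ : ∃ d, l = m.natAbs + d := ⟨l - m.natAbs, by omega⟩
  rw [Nat.add_sub_cancel_left, mul_pow]
  ring

theorem E3_coords (x : E3) : x 0 = ‖x‖ * sin (sphTheta x) * cos (sphPhi x) ∧
    x 1 = ‖x‖ * sin (sphTheta x) * sin (sphPhi x) ∧ x 2 = ‖x‖ * cos (sphTheta x) := by
  have hn := E3_norm_sq x
  have h2 : |x 2| ≤ ‖x‖ := by simpa using PiLp.norm_apply_le x 2
  have hz : ‖x‖ * cos (sphTheta x) = x 2 := by
    rcases eq_or_ne x 0 with rfl | hx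
    · simp
    · have hx := norm_pos_iff.mpr hx
      have h3 := abs_le.mp h2
      rw [sphTheta, cos_arccos]
      · field_simp
      · rw [le_div_iff₀ hx]; linarith
      · rw [div_le_iff₀ hx]; linarith
  have hs : 0 ≤ sin (sphTheta x) := by
    rw [sphTheta, sin_arccos]; positivity
  have hρ : ‖(⟨x 0, x 1⟩ : ℂ)‖ = ‖x‖ * sin (sphTheta x) := by
    rw [← sq_eq_sq₀ (norm_nonneg _) (by positivity), ← Complex.normSq_eq_norm_sq,
      Complex.normSq_mk, mul_pow, sin_sq]
    linear_combination (‖x‖ * cos (sphTheta x) + x 2) * hz - hn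
  refine ⟨?_, ?_, hz.symm⟩
  · have := Complex.norm_mul_cos_arg ⟨x 0, x 1⟩
    rw [hρ] at this
    exact this.symm
  · have := Complex.norm_mul_sin_arg ⟨x 0, x 1⟩
    rw [hρ] at this
    exact this.symm

/-! ### The stereographic form of the functions -/

/-- The conformal factor `2 / (|x|² + 1)`. -/
def cfac (x : E3) : ℝ := 2 / (‖x‖ ^ 2 + 1)

theorem cfac_pos (x : E3) : 0 < cfac x := by unfold cfac; positivity

theorem cfac_mul (x : E3) : cfac x * (‖x‖ ^ 2 + 1) = 2 :=
  div_mul_cancel₀ _ (by positivity)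

theorem cfac_le_two (x : E3) : cfac x ≤ 2 := by
  have := cfac_mul x
  nlinarith [cfac_pos x, sq_nonneg ‖x‖, mul_nonneg (cfac_pos x).le (sq_nonneg ‖x‖)]

/-- The inverse stereographic projection onto the unit sphere of `ℝ³ × ℝ`. -/
def stereo (x : E3) : E3 × ℝ := (cfac x • x, 1 - cfac x)

/-- The spherical harmonics on `S³`, as functions on the ambient space. -/
def sphHarm (α : ℕ × ℕ × ℤ) (p : E3 × ℝ) : ℝ :=
  (1 / √(akl α.1 α.2.1)) * (chebPoly (α.1 + 1) (α.2.1 + 1)).eval p.2 * solid α.2.1 α.2.2 p.1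

theorem Wfun_eq {α : ℕ × ℕ × ℤ} (hα : memLam α) (x : E3) :
    Wfun α x = √(cfac x) * sphHarm α (stereo x) := by
  obtain ⟨k, l, m⟩ := α
  have hm : m.natAbs ≤ l := hα.2
  obtain ⟨h0, h1, h2⟩ := E3_coords x
  have hw := cfac_mul x
  have ht : (‖x‖ ^ 2 - 1) / (‖x‖ ^ 2 + 1) = 1 - cfac x := by
    rw [div_eq_iff (by positivity)]
    linear_combination hw
  have hb : cfac x ≤ 2 := cfac_le_two x
  have hcos : cos (sphChi x) = 1 - cfac x := by
    rw [sphChi, ht, cos_arccos (by linarith) (by linarith [cfac_pos x])]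
  have hsin : sin (sphChi x) = cfac x * ‖x‖ := by
    rw [sphChi, ht, sin_arccos]
    rw [Real.sqrt_eq_iff_mul_self_eq (by nlinarith [cfac_pos x])
      (mul_nonneg (cfac_pos x).le (norm_nonneg x))]
    linear_combination -cfac x * hw
  have hs0 : 0 ≤ sin (sphTheta x) := by
    rw [sphTheta, sin_arccos]; positivity
  have hsol := solid_polar hm (r := cfac x * ‖x‖) (θ := sphTheta x) (φ := sphPhi x)
    (x := cfac x • x) (by simp only [PiLp.smul_apply, smul_eq_mul]; rw [h0]; ring)
    (by simp only [PiLp.smul_apply, smul_eq_mul]; rw [h1]; ring)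
    (by simp only [PiLp.smul_apply, smul_eq_mul]; rw [h2]; ring)
  have hsqrt : √(1 - cos (sphTheta x) ^ 2) = sin (sphTheta x) := by
    rw [← sin_sq, Real.sqrt_sq hs0]
  have hsign : ((-1 : ℝ) ^ m.natAbs) * (-1) ^ m.natAbs = 1 := by rw [← mul_pow]; simp
  simp only [Wfun, sphHarm, stereo, hsol]
  rw [show (2 / (‖x‖ ^ 2 + 1)) = cfac x from rfl]
  simp only [Yfun, Y2fun, Kfun, legendreP, chebDeriv, hsin, hcos, hsqrt, solidConst]
  rw [← legPoly, ← chebPoly]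
  linear_combination (√(cfac x) * (1 / √(akl k l)) * (cfac x * ‖x‖) ^ l
    * (chebPoly (k + 1) (l + 1)).eval (1 - cfac x) * √((2 * l + 1) / (2 * π))
    * √((Nat.factorial (l - m.natAbs)) / (Nat.factorial (l + m.natAbs)))
    * sin (sphTheta x) ^ m.natAbs * ymfun m (sphPhi x)
    * (legPoly l m.natAbs).eval (cos (sphTheta x)) / (2 ^ l * Nat.factorial l)) * hsign

theorem contDiff_azim (m : ℤ) : ContDiff ℝ (⊤ : ℕ∞) fun x : E3 => azim m (x 0) (x 1) := by
  have h : ContDiff ℝ (⊤ : ℕ∞) fun x : E3 => (((x 0 : ℝ) : ℂ) + ((x 1 : ℝ) : ℂ) * Complex.I)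
      ^ m.natAbs := by
    have h0 : ∀ i : Fin 3, ContDiff ℝ (⊤ : ℕ∞) fun x : E3 => ((x i : ℝ) : ℂ) := fun i =>
      Complex.ofRealCLM.contDiff.comp (by fun_prop : ContDiff ℝ (⊤ : ℕ∞) fun x : E3 => x i)
    exact ((h0 0).add ((h0 1).mul contDiff_const)).pow _
  unfold azim
  split_ifs
  · exact contDiff_const
  · exact Complex.reCLM.contDiff.comp h
  · exact Complex.imCLM.contDiff.comp h

theorem contDiff_solid (l : ℕ) (m : ℤ) : ContDiff ℝ (⊤ : ℕ∞) (solid l m) := by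
  unfold solid polyHom
  refine (contDiff_const.mul (contDiff_azim m)).mul (ContDiff.sum fun j _ => ?_)
  have := contDiff_norm_sq ℝ (E := E3) (n := (⊤ : ℕ∞))
  fun_prop

theorem contDiff_sphHarm (α : ℕ × ℕ × ℤ) : ContDiff ℝ (⊤ : ℕ∞) (sphHarm α) := by
  unfold sphHarm
  refine (contDiff_const.mul ?_).mul ((contDiff_solid _ _).comp contDiff_fst)
  exact ((chebPoly _ _).contDiff_aeval _).comp contDiff_snd

theorem contDiff_cfac : ContDiff ℝ (⊤ : ℕ∞) cfac := by
  unfold cfac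
  refine contDiff_const.div ((contDiff_norm_sq ℝ).add contDiff_const) fun x => ?_
  positivity

theorem contDiff_stereo : ContDiff ℝ (⊤ : ℕ∞) stereo :=
  (contDiff_cfac.smul contDiff_id).prodMk (contDiff_const.sub contDiff_cfac)

theorem contDiff_Wfun {α : ℕ × ℕ × ℤ} (hα : memLam α) : ContDiff ℝ (⊤ : ℕ∞) (Wfun α) := by
  rw [show Wfun α = fun x => √(cfac x) * sphHarm α (stereo x) from funext (Wfun_eq hα)]
  exact (contDiff_cfac.sqrt fun x => (cfac_pos x).ne').mul
    ((contDiff_sphHarm α).comp contDiff_stereo)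

/-- The unit sphere of `ℝ³ × ℝ`. -/
def sph3 : Set (E3 × ℝ) := {p | ‖p.1‖ ^ 2 + p.2 ^ 2 = 1}

theorem isCompact_sph3 : IsCompact sph3 := by
  refine Metric.isCompact_of_isClosed_isBounded ?_ ?_
  · exact isClosed_eq (by fun_prop) continuous_const
  · refine (Metric.isBounded_closedBall (x := (0 : E3 × ℝ)) (r := 1)).subset fun p hp => ?_
    have hp : ‖p.1‖ ^ 2 + p.2 ^ 2 = 1 := hp
    rw [mem_closedBall_zero_iff, Prod.norm_def, max_le_iff]
    constructor
    · nlinarith [sq_nonneg p.2, norm_nonneg p.1]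
    · rw [Real.norm_eq_abs, ← sq_le_one_iff_abs_le_one]
      nlinarith [sq_nonneg ‖p.1‖]

theorem stereo_mem (x : E3) : stereo x ∈ sph3 := by
  have hw := cfac_mul x
  simp only [sph3, stereo, Set.mem_ofPred_eq, norm_smul, Real.norm_eq_abs, mul_pow, sq_abs]
  linear_combination cfac x * hw

/-! ### Gradients and Laplacians -/

/-- `f` has gradient `g` near `x`, and the divergence of `g` at `x` is `L`. -/
def HasLapAt (f : E3 → ℝ) (g : E3 → E3) (L : ℝ) (x : E3) : Prop :=
  (∀ᶠ y in nhds x, HasGradientAt f (g y) y) ∧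
    ∃ D : E3 →L[ℝ] E3, HasFDerivAt g D x ∧ ∑ i, D (EuclideanSpace.single i 1) i = L

theorem HasLapAt.hasFDerivAt {f : E3 → ℝ} {g : E3 → E3} {L : ℝ} {x : E3} (h : HasLapAt f g L x) :
    HasFDerivAt f (InnerProductSpace.toDual ℝ E3 (g x)) x :=
  h.1.self_of_nhds.hasFDerivAt

theorem HasLapAt.congr {f f' : E3 → ℝ} {g : E3 → E3} {L : ℝ} {x : E3} (h : HasLapAt f g L x)
    (hf : ∀ᶠ y in nhds x, f' y = f y) : HasLapAt f' g L x := by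
  refine ⟨?_, h.2⟩
  filter_upwards [h.1, eventually_eventually_nhds.mpr hf] with y h1 h2
  exact h1.congr_of_eventuallyEq h2

theorem HasLapAt.congr_lap {f : E3 → ℝ} {g : E3 → E3} {L L' : ℝ} {x : E3} (h : HasLapAt f g L x)
    (hL : L = L') : HasLapAt f g L' x := hL ▸ h

theorem hasLapAt_const (c : ℝ) (x : E3) : HasLapAt (fun _ => c) (fun _ => 0) 0 x := by
  refine ⟨Eventually.of_forall fun y => hasGradientAt_const y c, 0, hasFDerivAt_const _ _, ?_⟩
  simp

theorem HasLapAt.add {f₁ f₂ : E3 → ℝ} {g₁ g₂ : E3 → E3} {L₁ L₂ : ℝ} {x : E3}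
    (h₁ : HasLapAt f₁ g₁ L₁ x) (h₂ : HasLapAt f₂ g₂ L₂ x) :
    HasLapAt (fun y => f₁ y + f₂ y) (fun y => g₁ y + g₂ y) (L₁ + L₂) x := by
  obtain ⟨e₁, D₁, d₁, t₁⟩ := h₁
  obtain ⟨e₂, D₂, d₂, t₂⟩ := h₂
  refine ⟨?_, D₁ + D₂, d₁.add d₂, ?_⟩
  · filter_upwards [e₁, e₂] with y h1 h2
    rw [hasGradientAt_iff_hasFDerivAt, map_add]
    exact h1.hasFDerivAt.add h2.hasFDerivAt
  · simp [Finset.sum_add_distrib, ← t₁, ← t₂]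

theorem inner_E3 (a b : E3) : ⟪a, b⟫ = a 0 * b 0 + a 1 * b 1 + a 2 * b 2 := by
  simp [PiLp.inner_apply, Fin.sum_univ_three, mul_comm]

theorem HasLapAt.mul {f₁ f₂ : E3 → ℝ} {g₁ g₂ : E3 → E3} {L₁ L₂ : ℝ} {x : E3}
    (h₁ : HasLapAt f₁ g₁ L₁ x) (h₂ : HasLapAt f₂ g₂ L₂ x) :
    HasLapAt (fun y => f₁ y * f₂ y) (fun y => f₁ y • g₂ y + f₂ y • g₁ y)
      (f₁ x * L₂ + f₂ x * L₁ + 2 * ⟪g₁ x, g₂ x⟫) x := by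
  have k₁ := h₁.hasFDerivAt
  have k₂ := h₂.hasFDerivAt
  obtain ⟨e₁, D₁, d₁, t₁⟩ := h₁
  obtain ⟨e₂, D₂, d₂, t₂⟩ := h₂
  refine ⟨?_, _, (k₁.fun_smul d₂).fun_add (k₂.fun_smul d₁), ?_⟩
  · filter_upwards [e₁, e₂] with y h1 h2
    rw [hasGradientAt_iff_hasFDerivAt, map_add, map_smul, map_smul]
    exact h1.hasFDerivAt.mul h2.hasFDerivAt
  · rw [← t₁, ← t₂, inner_E3]
    simp [Fin.sum_univ_three, EuclideanSpace.inner_single_right]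
    ring

theorem HasLapAt.comp {f : E3 → ℝ} {g : E3 → E3} {L : ℝ} {x : E3} (h : HasLapAt f g L x)
    {φ φ' : ℝ → ℝ} {φ'' : ℝ} (h1 : ∀ᶠ t in nhds (f x), HasDerivAt φ (φ' t) t)
    (h2 : HasDerivAt φ' φ'' (f x)) :
    HasLapAt (fun y => φ (f y)) (fun y => φ' (f y) • g y)
      (φ' (f x) * L + φ'' * ⟪g x, g x⟫) x := by
  have k := h.hasFDerivAt
  obtain ⟨e, D, d, t⟩ := h
  refine ⟨?_, _, (h2.comp_hasFDerivAt x k).fun_smul d, ?_⟩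
  · filter_upwards [e, k.continuousAt.eventually h1] with y h3 h4
    rw [hasGradientAt_iff_hasFDerivAt, map_smul]
    exact h4.comp_hasFDerivAt y h3.hasFDerivAt
  · rw [← t, inner_E3]
    simp [Fin.sum_univ_three, EuclideanSpace.inner_single_right]
    ring

theorem HasLapAt.rpow {f : E3 → ℝ} {g : E3 → E3} {L : ℝ} {x : E3} (h : HasLapAt f g L x)
    (hx : 0 < f x) (a : ℝ) :
    HasLapAt (fun y => f y ^ a) (fun y => (a * f y ^ (a - 1)) • g y)
      (a * (f x ^ a / f x) * L + a * (a - 1) * (f x ^ a / f x ^ 2) * ⟪g x, g x⟫) x := by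
  have h1 : ∀ᶠ t in nhds (f x), HasDerivAt (fun t : ℝ => t ^ a) (a * t ^ (a - 1)) t := by
    filter_upwards [lt_mem_nhds hx] with t ht
    exact Real.hasDerivAt_rpow_const (Or.inl ht.ne')
  refine (h.comp h1
    ((Real.hasDerivAt_rpow_const (p := a - 1) (Or.inl hx.ne')).const_mul a)).congr_lap ?_
  simp only [Real.rpow_sub_one hx.ne']
  field_simp

theorem hasLapAt_coord (i : Fin 3) (x : E3) :
    HasLapAt (fun y => y i) (fun _ => EuclideanSpace.single i 1) 0 x := by
  refine ⟨Eventually.of_forall fun y => ?_, 0, hasFDerivAt_const _ _, by simp⟩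
  rw [hasGradientAt_iff_hasFDerivAt]
  exact (EuclideanSpace.proj i : E3 →L[ℝ] ℝ).hasFDerivAt.congr_fderiv (by
    ext v; simp [EuclideanSpace.inner_single_left])

theorem hasLapAt_norm_sq (x : E3) : HasLapAt (fun y => ‖y‖ ^ 2) (fun y => (2 : ℝ) • y) 6 x := by
  refine ⟨Eventually.of_forall fun y => ?_, (2 : ℝ) • ContinuousLinearMap.id ℝ E3,
    (hasFDerivAt_id x).const_smul (2 : ℝ), ?_⟩
  · rw [hasGradientAt_iff_hasFDerivAt, map_smul]
    exact (hasStrictFDerivAt_norm_sq y).hasFDerivAt.congr_fderiv (by ext; simp)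
  · simp
    norm_num

theorem exists_hasLapAt_complex_pow (n : ℕ) : ∃ gC gS : E3 → E3, ∀ x : E3,
    HasLapAt (fun y => (((y 0 : ℝ) + (y 1 : ℝ) * Complex.I : ℂ) ^ n).re) gC 0 x ∧
    HasLapAt (fun y => (((y 0 : ℝ) + (y 1 : ℝ) * Complex.I : ℂ) ^ n).im) gS 0 x ∧
    gC x 0 = gS x 1 ∧ gC x 1 = -gS x 0 ∧ gC x 2 = 0 ∧ gS x 2 = 0 ∧
    ⟪gC x, x⟫ = n * (((x 0 : ℝ) + (x 1 : ℝ) * Complex.I : ℂ) ^ n).re ∧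
    ⟪gS x, x⟫ = n * (((x 0 : ℝ) + (x 1 : ℝ) * Complex.I : ℂ) ^ n).im := by
  induction n with
  | zero =>
    refine ⟨fun _ => 0, fun _ => 0, fun x => ?_⟩
    simp [hasLapAt_const]
  | succ n ih =>
    obtain ⟨gC, gS, h⟩ := ih
    refine ⟨fun y => ((y 0) • gC y +
        (((y 0 : ℝ) + (y 1 : ℝ) * Complex.I : ℂ) ^ n).re • EuclideanSpace.single 0 1) +
        ((-1 : ℝ) • ((y 1) • gS y +
        (((y 0 : ℝ) + (y 1 : ℝ) * Complex.I : ℂ) ^ n).im • EuclideanSpace.single 1 1) +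
        ((y 1) * (((y 0 : ℝ) + (y 1 : ℝ) * Complex.I : ℂ) ^ n).im) • (0 : E3)),
      fun y => ((y 0) • gS y +
        (((y 0 : ℝ) + (y 1 : ℝ) * Complex.I : ℂ) ^ n).im • EuclideanSpace.single 0 1) +
        ((y 1) • gC y +
        (((y 0 : ℝ) + (y 1 : ℝ) * Complex.I : ℂ) ^ n).re • EuclideanSpace.single 1 1),
      fun x => ?_⟩
    obtain ⟨hC, hS, h0, h1, h2, h3, h4, h5⟩ := h x
    rw [inner_E3] at h4 h5
    refine ⟨?_, ?_, ?_, ?_, ?_, ?_, ?_, ?_⟩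
    · refine ((((hasLapAt_coord 0 x).mul hC).add ((hasLapAt_const (-1) x).mul
        ((hasLapAt_coord 1 x).mul hS))).congr (Eventually.of_forall fun y => ?_)).congr_lap ?_
      · simp [pow_succ]
        ring
      · simp [EuclideanSpace.inner_single_left, h0]
    · refine ((((hasLapAt_coord 0 x).mul hS).add
        ((hasLapAt_coord 1 x).mul hC)).congr (Eventually.of_forall fun y => ?_)).congr_lap ?_
      · simp [pow_succ]
        ring
      · simp [EuclideanSpace.inner_single_left, h1]
    · simp [h0, h1]
      ring
    · simp [h0, h1]
      ring
    · simp [h2, h3]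
    · simp [h2, h3]
    · rw [inner_E3]
      simp [pow_succ]
      linear_combination x 0 * h4 - x 1 * h5
    · rw [inner_E3]
      simp [pow_succ]
      linear_combination x 0 * h5 + x 1 * h4

theorem exists_hasLapAt_azim (m : ℤ) (x : E3) : ∃ g : E3 → E3,
    HasLapAt (fun y => azim m (y 0) (y 1)) g 0 x ∧ g x 2 = 0 ∧
    ⟪g x, x⟫ = m.natAbs * azim m (x 0) (x 1) := by
  obtain ⟨gC, gS, h⟩ := exists_hasLapAt_complex_pow m.natAbs
  obtain ⟨hC, hS, -, -, h2, h3, h4, h5⟩ := h x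
  rcases lt_trichotomy m 0 with hm | hm | hm
  · refine ⟨gS, ?_⟩
    simp only [azim, hm.ne, hm.not_gt, if_false]
    exact ⟨hS, h3, h5⟩
  · refine ⟨fun _ => 0, ?_⟩
    simp [azim, hm, hasLapAt_const]
  · refine ⟨gC, ?_⟩
    simp only [azim, hm.ne', hm, if_false, if_true]
    exact ⟨hC, h2, h4⟩

theorem solid_smul {l : ℕ} {m : ℤ} (hm : m.natAbs ≤ l) (c : ℝ) (x : E3) :
    solid l m (c • x) = c ^ l * solid l m x := by
  obtain ⟨h0, h1, h2⟩ := E3_coords x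
  rw [solid_polar hm h0 h1 h2, solid_polar hm (r := c * ‖x‖) (θ := sphTheta x) (φ := sphPhi x)
    (by simp only [PiLp.smul_apply, smul_eq_mul]; rw [h0]; ring)
    (by simp only [PiLp.smul_apply, smul_eq_mul]; rw [h1]; ring)
    (by simp only [PiLp.smul_apply, smul_eq_mul]; rw [h2]; ring), mul_pow]
  ring

theorem solid_eq_of_ne {l : ℕ} {m : ℤ} {x : E3} (hx : x ≠ 0) :
    solid l m x = solidConst l m.natAbs * (azim m (x 0) (x 1) *
      ((‖x‖ ^ 2) ^ (((l - m.natAbs : ℕ) : ℝ) / 2) *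
        (legPoly l m.natAbs).eval (x 2 * (‖x‖ ^ 2) ^ (-(1 / 2) : ℝ)))) := by
  have hr : 0 < ‖x‖ := norm_pos_iff.mpr hx
  have h1 : (‖x‖ ^ 2) ^ (((l - m.natAbs : ℕ) : ℝ) / 2) = ‖x‖ ^ (l - m.natAbs) := by
    rw [← Real.rpow_natCast ‖x‖ 2, ← Real.rpow_mul hr.le, ← Real.rpow_natCast]
    congr 1
    push_cast
    ring
  have h2 : (‖x‖ ^ 2) ^ (-(1 / 2) : ℝ) = ‖x‖⁻¹ := by
    rw [← Real.rpow_natCast ‖x‖ 2, ← Real.rpow_mul hr.le, ← Real.rpow_neg_one]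
    congr 1
    norm_num
  have h3 := polyHom_smul (d := l - m.natAbs) (q := legPoly l m.natAbs)
    (fun j _ => coeff_legPoly_of_odd) ‖x‖ (x 2 * ‖x‖⁻¹) 1
  rw [show ‖x‖ * (x 2 * ‖x‖⁻¹) = x 2 by field_simp, mul_one,
    polyHom_one (natDegree_legPoly_le _ _)] at h3
  rw [solid, h3, h1, h2]
  ring

theorem exists_hasLapAt_solid {l : ℕ} {m : ℤ} (hm : m.natAbs ≤ l) {x : E3} (hx : x ≠ 0) :
    ∃ g : E3 → E3, HasLapAt (solid l m) g 0 x ∧ ⟪g x, x⟫ = l * solid l m x := by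
  obtain ⟨gA, hA, hA2, hAx⟩ := exists_hasLapAt_azim m x
  have hs : 0 < ‖x‖ ^ 2 := by positivity
  set q := legPoly l m.natAbs with hq
  set d : ℕ := l - m.natAbs with hd
  have hF := (hasLapAt_norm_sq x).rpow hs ((d : ℝ) / 2)
  have hκ := (hasLapAt_norm_sq x).rpow hs (-(1 / 2))
  have hv := (hasLapAt_coord 2 x).mul hκ
  have hQ := hv.comp (Eventually.of_forall fun t => q.hasDerivAt t) (q.derivative.hasDerivAt _)
  have hH := (hasLapAt_const (solidConst l m.natAbs) x).mul (hA.mul (hF.mul hQ))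
  have hκ2 : (‖x‖ ^ 2) ^ (-(1 / 2) : ℝ) * (‖x‖ ^ 2) ^ (-(1 / 2) : ℝ) = (‖x‖ ^ 2)⁻¹ := by
    rw [← Real.rpow_add hs, ← Real.rpow_neg_one]
    norm_num
  have hode := legPoly_gegenbauer l m.natAbs (x 2 * (‖x‖ ^ 2) ^ (-(1 / 2) : ℝ))
  rw [← hq] at hode
  have hld : (l : ℝ) = m.natAbs + d := by
    rw [hd, Nat.cast_sub hm]; ring
  have hxx : ⟪x, x⟫ = ‖x‖ ^ 2 := real_inner_self_eq_norm_sq x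
  have hxe : ⟪x, (EuclideanSpace.single 2 1 : E3)⟫ = x 2 := by
    simp [EuclideanSpace.inner_single_right]
  have hex : ⟪(EuclideanSpace.single 2 1 : E3), x⟫ = x 2 := by
    simp [EuclideanSpace.inner_single_left]
  have hee : ⟪(EuclideanSpace.single 2 1 : E3), (EuclideanSpace.single 2 1 : E3)⟫ = (1 : ℝ) := by
    simp
  have hAe : ⟪gA x, (EuclideanSpace.single 2 1 : E3)⟫ = 0 := by
    simp [EuclideanSpace.inner_single_right, hA2]
  refine ⟨_, (hH.congr ?_).congr_lap ?_, ?_⟩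
  · filter_upwards [isOpen_ne.mem_nhds hx] with y hy
    exact solid_eq_of_ne hy
  · simp only [inner_add_left, inner_add_right, real_inner_smul_left, real_inner_smul_right, hxx,
      hxe, hex, hee, hAe, hAx, inner_zero_left, Real.rpow_sub_one hs.ne']
    generalize (‖x‖ ^ 2) ^ ((d : ℝ) / 2) = F
    generalize (‖x‖ ^ 2) ^ (-(1 / 2) : ℝ) = κ at hκ2 hode ⊢
    generalize ‖x‖ ^ 2 = s at hs hκ2 ⊢
    rw [hld] at hode
    have hκ0 : κ ≠ 0 := by
      rintro rfl
      simp [hs.ne] at hκ2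
    obtain rfl : s = (κ * κ)⁻¹ := by rw [hκ2, inv_inv]
    clear hκ2 hs hH hQ hv hκ hF
    field_simp
    linear_combination 2 * F * solidConst l m.natAbs * azim m (x 0) (x 1) * κ ^ 2 * hode
  · rw [solid_eq_of_ne hx]
    simp only [inner_add_left, real_inner_smul_left, hxx, hex, hAx, inner_zero_left, Real.rpow_sub_one hs.ne']
    rw [hld]
    field_simp
    ring


theorem hasLapAt_cfac (x : E3) :
    HasLapAt cfac (fun y => (-(cfac y) ^ 2) • y) (cfac x ^ 2 - 2 * cfac x ^ 3) x := by
  have hs : ‖x‖ ^ 2 + 1 ≠ 0 := by positivity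
  have h1 : ∀ᶠ t in nhds (‖x‖ ^ 2 + 1), HasDerivAt (fun t : ℝ => 2 / t) (-2 / t ^ 2) t := by
    filter_upwards [isOpen_ne.mem_nhds hs] with t ht
    simpa [div_eq_mul_inv] using (hasDerivAt_inv ht).const_mul 2
  have h2 : HasDerivAt (fun t : ℝ => -2 / t ^ 2) (4 / (‖x‖ ^ 2 + 1) ^ 3) (‖x‖ ^ 2 + 1) := by
    refine ((hasDerivAt_const _ (-2 : ℝ)).fun_div (hasDerivAt_pow 2 _)
      (pow_ne_zero 2 hs)).congr_deriv ?_
    field_simp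
    ring
  have h := ((hasLapAt_norm_sq x).add (hasLapAt_const 1 x)).comp h1 h2
  have hg : (fun y : E3 => (-2 / (‖y‖ ^ 2 + 1) ^ 2) • ((2 : ℝ) • y + 0))
      = fun y => (-(cfac y) ^ 2) • y := by
    ext1 y
    rw [add_zero, smul_smul, cfac]
    congr 1
    field_simp
  rw [hg] at h
  refine h.congr_lap ?_
  simp only [add_zero, norm_smul, real_inner_self_eq_norm_sq, cfac, mul_pow, Real.norm_ofNat]
  field_simp
  ring

theorem pd3_eq_of_hasGradientAt {f : E3 → ℝ} {v x : E3} (h : HasGradientAt f v x) (i : Fin 3) :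
    pd3 i f x = v i := by
  rw [pd3, h.hasFDerivAt.fderiv]
  simp [EuclideanSpace.inner_single_right]

theorem HasLapAt.sum_pd3 {f : E3 → ℝ} {g : E3 → E3} {L : ℝ} {x : E3} (h : HasLapAt f g L x) :
    ∑ i, pd3 i (pd3 i f) x = L := by
  obtain ⟨e, D, d, t⟩ := h
  rw [← t]
  refine Finset.sum_congr rfl fun i _ => ?_
  have h1 : pd3 i f =ᶠ[nhds x] fun y => g y i := by
    filter_upwards [e] with y hy
    exact pd3_eq_of_hasGradientAt hy i
  have h2 : HasFDerivAt (fun y => g y i) ((EuclideanSpace.proj i : E3 →L[ℝ] ℝ) ∘L D) x :=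
    (EuclideanSpace.proj i : E3 →L[ℝ] ℝ).hasFDerivAt.comp x d
  rw [pd3, h1.fderiv_eq, h2.fderiv]
  simp

/-- The eigenvalue `(k + 1/2)(k + 3/2)` attached to the degree `k`. -/
def eigval (k : ℕ) : ℝ := (2 * (k : ℝ) + 1) * (2 * k + 3) / 4

theorem eigval_pos (k : ℕ) : 0 < eigval k := by unfold eigval; positivity

/-- The Arar–Boulmezaoud functions solve `-ΔW = (k+1/2)(k+3/2) cfac² W`. -/
theorem exists_hasLapAt_Wfun {α : ℕ × ℕ × ℤ} (hα : memLam α) {x : E3} (hx : x ≠ 0) :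
    ∃ g : E3 → E3, HasLapAt (Wfun α) g
      (-eigval α.1 * (cfac x ^ 2 * Wfun α x)) x := by
  unfold eigval
  obtain ⟨k, l, m⟩ := α
  obtain ⟨hlk, hml⟩ := hα
  simp only at hlk hml ⊢
  obtain ⟨gS, hS, hSx⟩ := exists_hasLapAt_solid hml hx
  have hw := cfac_pos x
  set τ := chebPoly (k + 1) (l + 1) with hτ
  have hP := (hasLapAt_cfac x).rpow hw ((l : ℝ) + 1 / 2)
  have hQ := (hasLapAt_cfac x).comp (φ := fun t => τ.eval (1 - t))
    (φ' := fun t => -(τ.derivative.eval (1 - t)))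
    (φ'' := τ.derivative.derivative.eval (1 - cfac x))
    (Eventually.of_forall fun t => by
      simpa [Function.comp_def] using
        (τ.hasDerivAt (1 - t)).comp t ((hasDerivAt_id t).const_sub 1))
    (by simpa [Function.comp_def] using ((τ.derivative.hasDerivAt (1 - cfac x)).comp (cfac x)
      ((hasDerivAt_id (cfac x)).const_sub 1)).fun_neg)
  have hH := (hasLapAt_const (1 / √(akl k l)) x).mul ((hP.mul hQ).mul hS)
  have hW : ∀ y, Wfun (k, l, m) y = 1 / √(akl k l) *
      (cfac y ^ ((l : ℝ) + 1 / 2) * τ.eval (1 - cfac y) * solid l m y) := fun y => by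
    rw [Wfun_eq ⟨hlk, hml⟩, sphHarm, stereo, solid_smul hml, Real.rpow_add (cfac_pos y),
      Real.rpow_natCast, ← Real.sqrt_eq_rpow]
    ring
  have hode := chebPoly_gegenbauer (k + 1) (l + 1) (1 - cfac x)
  rw [← hτ] at hode
  refine ⟨_, (hH.congr (Eventually.of_forall hW)).congr_lap ?_⟩
  have hc := cfac_mul x
  rw [hW x]
  have hxx : ⟪x, x⟫ = ‖x‖ ^ 2 := real_inner_self_eq_norm_sq x
  simp only [inner_add_left, real_inner_smul_left, real_inner_smul_right, hxx,
    real_inner_comm (gS x) x, hSx, inner_zero_left, Real.rpow_sub_one hw.ne']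
  generalize cfac x ^ ((l : ℝ) + 1 / 2) = P
  generalize 1 / √(akl k l) = c
  generalize ‖x‖ ^ 2 = s at hc ⊢
  clear hP hQ hH hW
  generalize cfac x = w at hc hode hw ⊢
  obtain rfl : s = 2 / w - 1 := by field_simp; linarith
  field_simp
  push_cast at hode
  linear_combination 16 * P * c * solid l m x * w ^ 2 * hode

/-! ### Decay and integrability -/

theorem cfac_mul_norm_sq (x : E3) : cfac x * ‖x‖ ^ 2 = 2 - cfac x := by
  linarith [cfac_mul x]

theorem cfac_mul_norm_le (x : E3) : cfac x * ‖x‖ ≤ 1 := by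
  nlinarith [cfac_mul x, cfac_pos x, mul_nonneg (cfac_pos x).le (sq_nonneg (‖x‖ - 1))]

theorem hasFDerivAt_cfac (x : E3) :
    HasFDerivAt cfac (InnerProductSpace.toDual ℝ E3 ((-(cfac x) ^ 2) • x)) x :=
  (hasLapAt_cfac x).hasFDerivAt

theorem norm_fderiv_sqrt_cfac_le (x : E3) : ‖fderiv ℝ (fun y => √(cfac y)) x‖ ≤ cfac x := by
  have hw := cfac_pos x
  have hs := Real.sqrt_pos.mpr hw
  have hss := Real.mul_self_sqrt hw.le
  rw [((hasFDerivAt_cfac x).sqrt hw.ne').fderiv, norm_smul, LinearIsometryEquiv.norm_map,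
    norm_smul, norm_neg, norm_pow, Real.norm_of_nonneg hw.le, Real.norm_of_nonneg (by positivity)]
  have h1 : √(cfac x) * ‖x‖ ≤ 2 := by
    refine abs_le_of_sq_le_sq' ?_ (by norm_num) |>.2
    rw [mul_pow, Real.sq_sqrt hw.le, cfac_mul_norm_sq]
    linarith
  rw [div_mul_eq_mul_div, one_mul, div_le_iff₀ (by positivity)]
  calc cfac x ^ 2 * ‖x‖ = cfac x * √(cfac x) * (√(cfac x) * ‖x‖) := by
        linear_combination (-cfac x * ‖x‖) * hss
    _ ≤ cfac x * √(cfac x) * 2 := by gcongr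
    _ = cfac x * (2 * √(cfac x)) := by ring

theorem norm_fderiv_stereo_le (x : E3) : ‖fderiv ℝ stereo x‖ ≤ 3 * cfac x := by
  have hw := cfac_pos x
  have h := hasFDerivAt_cfac x
  have hst : HasFDerivAt stereo _ x :=
    (h.fun_smul (hasFDerivAt_id x)).prodMk (h.const_sub 1)
  rw [hst.fderiv]
  refine ContinuousLinearMap.opNorm_le_bound _ (by positivity) fun v => ?_
  have hv : |⟪x, v⟫| ≤ ‖x‖ * ‖v‖ := abs_real_inner_le_norm x v
  simp only [ContinuousLinearMap.prod_apply, Prod.norm_mk, add_apply,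
    smul_apply, ContinuousLinearMap.smulRight_apply, neg_apply,
    InnerProductSpace.toDual_apply_apply, real_inner_smul_left, ContinuousLinearMap.id_apply, id]
  have hx1 := cfac_mul_norm_le x
  have h2 : ‖-cfac x ^ 2 * ⟪x, v⟫‖ ≤ cfac x ^ 2 * (‖x‖ * ‖v‖) := by
    rw [norm_mul, norm_neg, norm_pow, Real.norm_of_nonneg hw.le]
    gcongr
    exact hv
  refine max_le ?_ ?_
  · refine (norm_add_le _ _).trans ?_
    rw [norm_smul, norm_smul, Real.norm_of_nonneg hw.le]
    have : ‖-cfac x ^ 2 * ⟪x, v⟫‖ * ‖x‖ ≤ cfac x * 2 * ‖v‖ := by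
      calc _ ≤ cfac x ^ 2 * (‖x‖ * ‖v‖) * ‖x‖ := by gcongr
        _ = cfac x * (cfac x * ‖x‖ ^ 2) * ‖v‖ := by ring
        _ ≤ cfac x * 2 * ‖v‖ := by
          gcongr
          rw [cfac_mul_norm_sq]
          linarith
    linarith
  · rw [norm_neg]
    refine h2.trans ?_
    calc cfac x ^ 2 * (‖x‖ * ‖v‖) = cfac x * ((cfac x * ‖x‖) * ‖v‖) := by ring
      _ ≤ cfac x * (1 * ‖v‖) := by gcongr
      _ ≤ 3 * cfac x * ‖v‖ := by nlinarith [norm_nonneg v]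

theorem exists_bound_sphHarm (α : ℕ × ℕ × ℤ) :
    ∃ C, 0 ≤ C ∧ ∀ p ∈ sph3, |sphHarm α p| ≤ C ∧ ‖fderiv ℝ (sphHarm α) p‖ ≤ C := by
  obtain ⟨C₁, h₁⟩ := isCompact_sph3.exists_bound_of_continuousOn
    (contDiff_sphHarm α).continuous.continuousOn
  obtain ⟨C₂, h₂⟩ := isCompact_sph3.exists_bound_of_continuousOn
    ((contDiff_sphHarm α).continuous_fderiv (by simp)).continuousOn
  have h0 := stereo_mem 0
  refine ⟨max C₁ C₂, (norm_nonneg _).trans ((h₁ _ h0).trans (le_max_left _ _)), fun p hp => ⟨?_, ?_⟩⟩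
  · exact (h₁ p hp).trans (le_max_left _ _)
  · exact (h₂ p hp).trans (le_max_right _ _)

theorem norm_gradient (f : E3 → ℝ) (x : E3) : ‖gradient f x‖ = ‖fderiv ℝ f x‖ := by
  rw [gradient, LinearIsometryEquiv.norm_map]

theorem exists_bound_Wfun {α : ℕ × ℕ × ℤ} (hα : memLam α) :
    ∃ C, 0 ≤ C ∧ ∀ x, |Wfun α x| ≤ C * √(cfac x) ∧ ‖gradient (Wfun α) x‖ ≤ C * cfac x := by
  obtain ⟨C, hC, h⟩ := exists_bound_sphHarm α
  refine ⟨7 * C, by positivity, fun x => ?_⟩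
  obtain ⟨h1, h2⟩ := h _ (stereo_mem x)
  have hw := cfac_pos x
  have hs := Real.sqrt_nonneg (cfac x)
  constructor
  · rw [Wfun_eq hα, abs_mul, abs_of_nonneg hs, mul_comm]
    gcongr
    linarith
  · have hW : Wfun α = fun y => √(cfac y) * sphHarm α (stereo y) := funext (Wfun_eq hα)
    have d1 : DifferentiableAt ℝ (fun y => √(cfac y)) x :=
      (hasFDerivAt_cfac x).differentiableAt.sqrt hw.ne'
    have d2 : DifferentiableAt ℝ stereo x :=
      contDiff_stereo.differentiable (by simp) x
    have d3 : DifferentiableAt ℝ (sphHarm α) (stereo x) :=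
      (contDiff_sphHarm α).differentiable (by simp) _
    have d4 : HasFDerivAt (fun y => √(cfac y) * sphHarm α (stereo y)) _ x :=
      d1.hasFDerivAt.fun_mul (d3.hasFDerivAt.comp x d2.hasFDerivAt)
    rw [norm_gradient, hW, d4.fderiv]
    refine (norm_add_le _ _).trans ?_
    rw [norm_smul, norm_smul, Real.norm_of_nonneg hs, Real.norm_eq_abs]
    have h4 : ‖(fderiv ℝ (sphHarm α) (stereo x)).comp (fderiv ℝ stereo x)‖ ≤ C * (3 * cfac x) :=
      (ContinuousLinearMap.opNorm_comp_le _ _).trans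
        (mul_le_mul h2 (norm_fderiv_stereo_le x) (norm_nonneg _) hC)
    have h5 : √(cfac x) ≤ 2 := by
      rw [Real.sqrt_le_left (by norm_num)]
      linarith [cfac_le_two x]
    have h6 : √(cfac x) * ‖(fderiv ℝ (sphHarm α) (stereo x)).comp (fderiv ℝ stereo x)‖
        ≤ 2 * (C * (3 * cfac x)) := by gcongr
    have h7 : |sphHarm α (stereo x)| * ‖fderiv ℝ (fun y => √(cfac y)) x‖ ≤ C * cfac x :=
      mul_le_mul h1 (norm_fderiv_sqrt_cfac_le x) (norm_nonneg _) hC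
    calc _ ≤ 2 * (C * (3 * cfac x)) + C * cfac x := add_le_add h6 h7
      _ = 7 * C * cfac x := by ring

theorem continuous_cfac : Continuous cfac := contDiff_cfac.continuous

theorem integrable_cfac_sq : Integrable (fun x : E3 => cfac x ^ 2) := by
  have h := (integrable_rpow_neg_one_add_norm_sq (E := E3) (μ := volume) (r := 4)
    (by simp; norm_num)).const_mul 4
  refine h.congr (Eventually.of_forall fun x => ?_)
  simp only [cfac]
  rw [show (-4 / 2 : ℝ) = -(2 : ℕ) by norm_num, Real.rpow_neg (by positivity), Real.rpow_natCast]
  field_simp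
  ring

theorem integrable_cfac_cube : Integrable (fun x : E3 => cfac x ^ 3) := by
  refine (integrable_cfac_sq.const_mul 2).mono' (continuous_cfac.pow 3).aestronglyMeasurable ?_
  refine Eventually.of_forall fun x => ?_
  rw [Real.norm_of_nonneg (pow_nonneg (cfac_pos x).le 3)]
  nlinarith [cfac_le_two x, cfac_pos x, sq_nonneg (cfac x)]

theorem continuous_Wfun {α : ℕ × ℕ × ℤ} (hα : memLam α) : Continuous (Wfun α) :=
  (contDiff_Wfun hα).continuous

theorem continuous_gradient_Wfun {α : ℕ × ℕ × ℤ} (hα : memLam α) :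
    Continuous (gradient (Wfun α)) :=
  (InnerProductSpace.toDual ℝ E3).symm.continuous.comp
    ((contDiff_Wfun hα).continuous_fderiv (by simp))

theorem gradient_apply (f : E3 → ℝ) (x : E3) (i : Fin 3) : gradient f x i = pd3 i f x := by
  have h : ⟪gradient f x, EuclideanSpace.single i 1⟫ = fderiv ℝ f x (EuclideanSpace.single i 1) := by
    simp [gradient]
  rw [pd3, ← h, EuclideanSpace.inner_single_right]
  simp

theorem memLp_gradient_Wfun {α : ℕ × ℕ × ℤ} (hα : memLam α) :
    MemLp (gradient (Wfun α)) 2 volume := by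
  rw [memLp_two_iff_integrable_sq_norm (continuous_gradient_Wfun hα).aestronglyMeasurable]
  obtain ⟨C, hC, h⟩ := exists_bound_Wfun hα
  refine (integrable_cfac_sq.const_mul (C ^ 2)).mono'
    ((continuous_gradient_Wfun hα).norm.pow 2).aestronglyMeasurable
    (Eventually.of_forall fun x => ?_)
  rw [Real.norm_of_nonneg (by positivity), ← mul_pow]
  gcongr
  exact (h x).2

theorem isWeakGradient_Wfun {α : ℕ × ℕ × ℤ} (hα : memLam α) :
    IsWeakGradient (Wfun α) (gradient (Wfun α)) := by
  intro φ hφ hc i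
  have hW := contDiff_Wfun hα
  have c1 : Continuous fun x => fderiv ℝ φ x (EuclideanSpace.single i 1) :=
    (hφ.continuous_fderiv (by simp)).clm_apply continuous_const
  have c2 : Continuous fun x => fderiv ℝ (Wfun α) x (EuclideanSpace.single i 1) :=
    (hW.continuous_fderiv (by simp)).clm_apply continuous_const
  simp only [gradient_apply]
  refine integral_mul_fderiv_eq_neg_fderiv_mul_of_integrable ?_ ?_ ?_
    (fun x _ => hW.differentiable (by simp) x) (fun x _ => hφ.differentiable (by simp) x)
  · exact (c2.mul hφ.continuous).integrable_of_hasCompactSupport hc.mul_left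
  · exact (hW.continuous.mul c1).integrable_of_hasCompactSupport (hc.fderiv_apply ℝ _).mul_left
  · exact (hW.continuous.mul hφ.continuous).integrable_of_hasCompactSupport hc.mul_left

theorem one_add_norm_sq_inv (x : E3) : (1 + ‖x‖ ^ 2)⁻¹ = cfac x / 2 := by
  rw [cfac]
  field_simp
  ring

theorem memW10_Wfun {α : ℕ × ℕ × ℤ} (hα : memLam α) : MemW10 (Wfun α) (gradient (Wfun α)) := by
  refine ⟨(continuous_Wfun hα).locallyIntegrable, ?_,
    (continuous_gradient_Wfun hα).aestronglyMeasurable, isWeakGradient_Wfun hα,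
    (memLp_gradient_Wfun hα).integrable_norm_pow (by norm_num)⟩
  obtain ⟨C, hC, h⟩ := exists_bound_Wfun hα
  have hc : Continuous fun x : E3 => (Wfun α x) ^ 2 / (1 + ‖x‖ ^ 2) :=
    ((continuous_Wfun hα).pow 2).div (by fun_prop) fun x => by positivity
  refine (integrable_cfac_sq.const_mul (C ^ 2)).mono' hc.aestronglyMeasurable
    (Eventually.of_forall fun x => ?_)
  have hw := cfac_pos x
  rw [Real.norm_of_nonneg (by positivity), div_eq_mul_inv, one_add_norm_sq_inv, ← sq_abs]
  have h1 : |Wfun α x| ^ 2 ≤ C ^ 2 * cfac x := by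
    calc |Wfun α x| ^ 2 ≤ (C * √(cfac x)) ^ 2 := by gcongr; exact (h x).1
      _ = C ^ 2 * cfac x := by rw [mul_pow, Real.sq_sqrt hw.le]
  calc _ ≤ C ^ 2 * cfac x * (cfac x / 2) := by gcongr
    _ ≤ C ^ 2 * cfac x ^ 2 := by nlinarith [mul_nonneg (sq_nonneg C) (sq_nonneg (cfac x))]

/-! ### Integration by parts against the Arar–Boulmezaoud functions -/

theorem exists_cutoff : ∃ (χ : ℕ → E3 → ℝ) (M : ℝ), 0 ≤ M ∧ (∀ n, ContDiff ℝ (⊤ : ℕ∞) (χ n)) ∧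
    (∀ n, HasCompactSupport (χ n)) ∧ (∀ n x, |χ n x| ≤ 1) ∧
    (∀ x, Tendsto (fun n => χ n x) atTop (nhds 1)) ∧
    (∀ n x, ‖fderiv ℝ (χ n) x‖ ≤ M * √(cfac x)) ∧
    (∀ x, Tendsto (fun n => fderiv ℝ (χ n) x) atTop (nhds 0)) := by
  let f : ContDiffBump (0 : E3) := ⟨1, 2, one_pos, one_lt_two⟩
  have hf : ContDiff ℝ (⊤ : ℕ∞) f := f.contDiff
  obtain ⟨M, hM⟩ := (f.hasCompactSupport.fderiv ℝ).exists_bound_of_continuous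
    (hf.continuous_fderiv (by simp))
  have hM0 : 0 ≤ M := (norm_nonneg _).trans (hM 0)
  let c : ℕ → ℝ := fun n => ((n : ℝ) + 1)⁻¹
  have hc : ∀ n, 0 < c n := fun n => by positivity
  have hc0 : Tendsto c atTop (nhds 0) := by
    simpa [c, one_div] using tendsto_one_div_add_atTop_nhds_zero_nat (𝕜 := ℝ)
  have hd : ∀ n x, fderiv ℝ (fun y => f (c n • y)) x = c n • fderiv ℝ f (c n • x) := fun n x => by
    rw [fderiv_comp_smul]
  refine ⟨fun n x => f (c n • x), 3 * M, by positivity, fun n => hf.comp (contDiff_const_smul _),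
    fun n => f.hasCompactSupport.comp_smul (hc n).ne', fun n x => ?_, fun x => ?_, fun n x => ?_,
    fun x => ?_⟩
  · rw [abs_of_nonneg f.nonneg]
    exact f.le_one
  · have h1 : Tendsto (fun n => c n • x) atTop (nhds 0) := by
      simpa using hc0.smul_const x
    have h2 := (hf.continuous.tendsto 0).comp h1
    rwa [f.one_of_mem_closedBall (by simp [f])] at h2
  · rw [hd, norm_smul, Real.norm_of_nonneg (hc n).le]
    by_cases hx : c n • x ∈ tsupport f
    · rw [f.tsupport_eq, mem_closedBall_zero_iff, norm_smul, Real.norm_of_nonneg (hc n).le] at hx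
      have hx' : c n * ‖x‖ ≤ 2 := hx
      have hc1 : c n ≤ 1 := by
        simp only [c]
        exact inv_le_one_of_one_le₀ (by linarith [n.cast_nonneg (α := ℝ)])
      have h3 : c n ≤ 3 * √(cfac x) := by
        refine (abs_le_of_sq_le_sq' ?_ (by positivity)).2
        rw [mul_pow, Real.sq_sqrt (cfac_pos x).le, cfac, mul_div_assoc', le_div_iff₀ (by positivity)]
        have : (c n * ‖x‖) ^ 2 ≤ 2 ^ 2 := by
          have := mul_nonneg (hc n).le (norm_nonneg x)
          gcongr
        nlinarith [hc n]
      calc c n * ‖fderiv ℝ f (c n • x)‖ ≤ (3 * √(cfac x)) * M := by gcongr; exact hM _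
        _ = 3 * M * √(cfac x) := by ring
    · have : fderiv ℝ f (c n • x) = 0 := by
        by_contra h
        exact hx (support_fderiv_subset ℝ h)
      rw [this]
      simp only [norm_zero, mul_zero]
      positivity
  · refine squeeze_zero_norm (a := fun n => c n * M) (fun n => ?_) (by simpa using hc0.mul_const M)
    rw [hd, norm_smul, Real.norm_of_nonneg (hc n).le]
    exact mul_le_mul_of_nonneg_left (hM _) (hc n).le

theorem MemW10.integrable_sq_mul_cfac {U : E3 → ℝ} {G : E3 → E3} (h : MemW10 U G) :
    Integrable (fun x => U x ^ 2 * cfac x) := by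
  refine (h.2.1.const_mul 2).congr (Eventually.of_forall fun x => ?_)
  simp only [div_eq_mul_inv, one_add_norm_sq_inv]
  ring

theorem MemW10.aestronglyMeasurable {U : E3 → ℝ} {G : E3 → E3} (h : MemW10 U G) :
    AEStronglyMeasurable U volume := h.1.aestronglyMeasurable

theorem integrable_inner_gradient_Wfun {G : E3 → E3} (hG : MemLp G 2 volume)
    {α : ℕ × ℕ × ℤ} (hα : memLam α) : Integrable (fun x => ⟪G x, gradient (Wfun α) x⟫) := by
  refine (hG.norm.integrable_mul (memLp_gradient_Wfun hα).norm).mono'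
    (hG.1.inner (memLp_gradient_Wfun hα).1) (Eventually.of_forall fun x => ?_)
  exact abs_real_inner_le_norm _ _

theorem MemW10.memLp {U : E3 → ℝ} {G : E3 → E3} (h : MemW10 U G) : MemLp G 2 volume :=
  (memLp_two_iff_integrable_sq_norm h.2.2.1).mpr h.2.2.2.2

theorem MemW10.integrable_mul_Wfun {U : E3 → ℝ} {G : E3 → E3} (h : MemW10 U G)
    {α : ℕ × ℕ × ℤ} (hα : memLam α) : Integrable (fun x => cfac x ^ 2 * (U x * Wfun α x)) := by
  have h2 := (memW10_Wfun hα).integrable_sq_mul_cfac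
  refine ((h.integrable_sq_mul_cfac.add h2).const_mul 2).mono'
    ((continuous_cfac.pow 2).aestronglyMeasurable.mul
      (h.aestronglyMeasurable.mul (continuous_Wfun hα).aestronglyMeasurable))
    (Eventually.of_forall fun x => ?_)
  have hw := cfac_pos x
  have hw2 := cfac_le_two x
  simp only [Pi.add_apply]
  rw [norm_mul, norm_pow, Real.norm_of_nonneg hw.le, norm_mul, Real.norm_eq_abs, Real.norm_eq_abs,
    ← sq_abs (U x), ← sq_abs (Wfun α x)]
  have h3 : |U x| * |Wfun α x| ≤ |U x| ^ 2 + |Wfun α x| ^ 2 := by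
    nlinarith [sq_nonneg (|U x| - |Wfun α x|), abs_nonneg (U x), abs_nonneg (Wfun α x)]
  calc _ ≤ cfac x ^ 2 * (|U x| ^ 2 + |Wfun α x| ^ 2) := by gcongr
    _ = cfac x * (cfac x * (|U x| ^ 2 + |Wfun α x| ^ 2)) := by ring
    _ ≤ 2 * (cfac x * (|U x| ^ 2 + |Wfun α x| ^ 2)) := by gcongr
    _ = _ := by ring

theorem pd3_mul {f g : E3 → ℝ} {x : E3} (hf : DifferentiableAt ℝ f x)
    (hg : DifferentiableAt ℝ g x) (i : Fin 3) :
    pd3 i (fun y => f y * g y) x = f x * pd3 i g x + g x * pd3 i f x := by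
  rw [pd3, fderiv_fun_mul hf hg]
  simp [pd3]

theorem contDiff_pd3 {f : E3 → ℝ} (hf : ContDiff ℝ (⊤ : ℕ∞) f) (i : Fin 3) :
    ContDiff ℝ (⊤ : ℕ∞) (pd3 i f) :=
  (hf.fderiv_right (m := (⊤ : ℕ∞)) (by simp)).clm_apply contDiff_const

/-- Pairing with `Wfun α` in the energy space is a multiple of the weighted `L²` pairing. -/
theorem MemW10.green {U : E3 → ℝ} {G : E3 → E3} (h : MemW10 U G)
    {α : ℕ × ℕ × ℤ} (hα : memLam α) :
    ∫ x, ⟪G x, gradient (Wfun α) x⟫ = eigval α.1 * ∫ x, cfac x ^ 2 * (U x * Wfun α x) := by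
  obtain ⟨χ, M, hM0, hχ, hχc, hχ1, hχt, hdχ, hdχt⟩ := exists_cutoff
  have hW := contDiff_Wfun hα
  have hU := h.aestronglyMeasurable
  have hgW := (continuous_gradient_Wfun hα).aestronglyMeasurable (μ := (volume : Measure E3))
  have hsmooth : ∀ n i, ContDiff ℝ (⊤ : ℕ∞) fun x => χ n x * pd3 i (Wfun α) x :=
    fun n i => (hχ n).mul (contDiff_pd3 hW i)
  have hcomp : ∀ n i, HasCompactSupport fun x => χ n x * pd3 i (Wfun α) x :=
    fun n i => (hχc n).mul_right
  have hkey : ∀ n, ∫ x, (U x * ⟪gradient (χ n) x, gradient (Wfun α) x⟫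
      - eigval α.1 * (χ n x * (cfac x ^ 2 * (U x * Wfun α x)))) =
      -∫ x, χ n x * ⟪G x, gradient (Wfun α) x⟫ := fun n => by
    have h1 : ∀ i, Integrable fun x => U x * pd3 i (fun y => χ n y * pd3 i (Wfun α) y) x := fun i => by
      simpa [mul_comm] using h.1.integrable_smul_left_of_hasCompactSupport
        (contDiff_pd3 (hsmooth n i) i).continuous ((hcomp n i).fderiv_apply ℝ _)
    have h2 : ∀ i, Integrable fun x => G x i * (χ n x * pd3 i (Wfun α) x) := fun i => by
      have hGi : MemLp (fun x => G x i) 2 volume :=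
        (EuclideanSpace.proj i : E3 →L[ℝ] ℝ).comp_memLp' h.memLp
      simpa [mul_comm] using (hGi.locallyIntegrable (by norm_num)).integrable_smul_left_of_hasCompactSupport
        (hsmooth n i).continuous (hcomp n i)
    have h3 : ∫ x, ∑ i, U x * pd3 i (fun y => χ n y * pd3 i (Wfun α) y) x =
        -∫ x, ∑ i, G x i * (χ n x * pd3 i (Wfun α) x) := by
      rw [integral_finsetSum _ fun i _ => h1 i, integral_finsetSum _ fun i _ => h2 i,
        ← Finset.sum_neg_distrib]
      exact Finset.sum_congr rfl fun i _ => h.2.2.2.1 _ (hsmooth n i) (hcomp n i) i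
    convert h3 using 1
    · refine integral_congr_ae ?_
      have h0 : ∀ᵐ x : E3, x ≠ 0 := by simp [ae_iff]
      filter_upwards [h0] with x hx
      obtain ⟨g, hg⟩ := exists_hasLapAt_Wfun hα hx
      have hlap := hg.sum_pd3
      have hd1 : DifferentiableAt ℝ (χ n) x := (hχ n).differentiable (by simp) x
      have hd2 : ∀ i, DifferentiableAt ℝ (pd3 i (Wfun α)) x := fun i =>
        (contDiff_pd3 hW i).differentiable (by simp) x
      simp only [pd3_mul hd1 (hd2 _)]
      rw [inner_E3]
      simp only [gradient_apply, Fin.sum_univ_three] at hlap ⊢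
      linear_combination (-U x * χ n x) * hlap
    · congr 1
      refine integral_congr_ae (Eventually.of_forall fun x => ?_)
      simp only [inner_E3, gradient_apply, Fin.sum_univ_three]
      ring
  have hbound : Integrable fun x => M * (U x ^ 2 * cfac x + ‖gradient (Wfun α) x‖ ^ 2) +
      eigval α.1 * ‖cfac x ^ 2 * (U x * Wfun α x)‖ :=
    ((h.integrable_sq_mul_cfac.add
      ((memLp_gradient_Wfun hα).integrable_norm_pow (by norm_num))).const_mul M).add
      ((h.integrable_mul_Wfun hα).norm.const_mul _)
  have hL : Tendsto (fun n => ∫ x, (U x * ⟪gradient (χ n) x, gradient (Wfun α) x⟫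
      - eigval α.1 * (χ n x * (cfac x ^ 2 * (U x * Wfun α x))))) atTop
      (nhds (∫ x, -(eigval α.1 * (cfac x ^ 2 * (U x * Wfun α x))))) := by
    refine tendsto_integral_of_dominated_convergence _ (fun n => ?_) hbound (fun n => ?_) ?_
    · have hgc : Continuous (gradient (χ n)) :=
        (InnerProductSpace.toDual ℝ E3).symm.continuous.comp ((hχ n).continuous_fderiv (by simp))
      exact (hU.mul (hgc.inner (continuous_gradient_Wfun hα)).aestronglyMeasurable).sub
        (((hχ n).continuous.aestronglyMeasurable.mul
          (h.integrable_mul_Wfun hα).aestronglyMeasurable).const_mul _)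
    · refine Eventually.of_forall fun x => (norm_sub_le _ _).trans ?_
      have hw := cfac_pos x
      have e0 := eigval_pos α.1
      refine add_le_add ?_ ?_
      · have i1 : |⟪gradient (χ n) x, gradient (Wfun α) x⟫| ≤
            M * √(cfac x) * ‖gradient (Wfun α) x‖ := by
          refine (abs_real_inner_le_norm _ _).trans ?_
          gcongr
          rw [norm_gradient]
          exact hdχ n x
        rw [norm_mul, Real.norm_eq_abs, Real.norm_eq_abs]
        calc _ ≤ |U x| * (M * √(cfac x) * ‖gradient (Wfun α) x‖) := by gcongr
          _ = M * ((|U x| * √(cfac x)) * ‖gradient (Wfun α) x‖) := by ring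
          _ ≤ M * ((|U x| * √(cfac x)) ^ 2 + ‖gradient (Wfun α) x‖ ^ 2) := by
            gcongr
            nlinarith [sq_nonneg (|U x| * √(cfac x)), sq_nonneg ‖gradient (Wfun α) x‖,
              sq_nonneg (|U x| * √(cfac x) - ‖gradient (Wfun α) x‖)]
          _ = _ := by rw [mul_pow, Real.sq_sqrt hw.le, sq_abs]
      · rw [norm_mul, norm_mul, Real.norm_of_nonneg e0.le, Real.norm_eq_abs (χ n x)]
        gcongr
        exact mul_le_of_le_one_left (norm_nonneg _) (hχ1 n x)
    · refine Eventually.of_forall fun x => ?_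
      have t1 : Tendsto (fun n => gradient (χ n) x) atTop (nhds 0) := by
        have := ((InnerProductSpace.toDual ℝ E3).symm.continuous.tendsto 0).comp (hdχt x)
        rwa [map_zero] at this
      have t2 := ((t1.inner (tendsto_const_nhds (x := gradient (Wfun α) x))).const_mul (U x)).sub
        (((hχt x).mul_const (cfac x ^ 2 * (U x * Wfun α x))).const_mul (eigval α.1))
      simpa using t2
  have hR : Tendsto (fun n => -∫ x, χ n x * ⟪G x, gradient (Wfun α) x⟫) atTop
      (nhds (-∫ x, ⟪G x, gradient (Wfun α) x⟫)) := by
    have hi := integrable_inner_gradient_Wfun h.memLp hα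
    refine (tendsto_integral_of_dominated_convergence _ (fun n => ?_) hi.norm (fun n => ?_) ?_).neg
    · exact (hχ n).continuous.aestronglyMeasurable.mul hi.aestronglyMeasurable
    · refine Eventually.of_forall fun x => ?_
      rw [norm_mul]
      exact mul_le_of_le_one_left (norm_nonneg _) (hχ1 n x)
    · refine Eventually.of_forall fun x => ?_
      simpa using (hχt x).mul_const ⟪G x, gradient (Wfun α) x⟫
  simp only [hkey] at hL
  have := tendsto_nhds_unique hL hR
  rw [integral_neg, integral_const_mul] at this
  linarith

/-! ### Orthonormality with respect to the weight `cfac³` -/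

/-- The coordinates `(x₂, (x₀, x₁))` as a measurable equivalence. -/
def splitLast : E3 ≃ᵐ ℝ × (ℝ × ℝ) :=
  (MeasurableEquiv.toLp 2 (Fin 3 → ℝ)).symm.trans
    ((MeasurableEquiv.piFinSuccAbove (fun _ : Fin 3 => ℝ) 2).trans
      ((MeasurableEquiv.refl ℝ).prodCongr (MeasurableEquiv.finTwoArrow (α := ℝ))))

theorem splitLast_apply (x : E3) : splitLast x = (x 2, (x 0, x 1)) := rfl

theorem measurePreserving_splitLast : MeasurePreserving splitLast volume volume :=
  (((MeasurePreserving.id volume).prod (volume_preserving_finTwoArrow ℝ)).comp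
    (volume_preserving_piFinSuccAbove (fun _ : Fin 3 => ℝ) 2)).comp
    (EuclideanSpace.volume_preserving_symm_measurableEquiv_toLp (Fin 3))

theorem splitLast_symm_apply (z a b : ℝ) : splitLast.symm (z, (a, b)) = !₂[a, b, z] := by
  rw [MeasurableEquiv.symm_apply_eq, splitLast_apply]
  simp

theorem integrable_plane_decay :
    Integrable (fun p : ℝ × ℝ => (2 / (p.1 ^ 2 + p.2 ^ 2 + 1)) ^ 2) := by
  have h := (integrable_rpow_neg_one_add_norm_sq (E := ℝ × ℝ) (μ := volume) (r := 4)
    (by simp; norm_num)).const_mul 4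
  have hc : Continuous fun p : ℝ × ℝ => (2 / (p.1 ^ 2 + p.2 ^ 2 + 1)) ^ 2 :=
    (continuous_const.div (by fun_prop) fun p => by positivity).pow 2
  refine h.mono' hc.aestronglyMeasurable (Eventually.of_forall fun p => ?_)
  have hp : ‖p‖ ^ 2 ≤ p.1 ^ 2 + p.2 ^ 2 := by
    rw [Prod.norm_def, Real.norm_eq_abs, Real.norm_eq_abs]
    rcases max_choice |p.1| |p.2| with h | h <;> rw [h, sq_abs] <;>
      nlinarith [sq_nonneg p.1, sq_nonneg p.2]
  rw [show (-4 / 2 : ℝ) = -(2 : ℕ) by norm_num, Real.rpow_neg (by positivity), Real.rpow_natCast,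
    Real.norm_of_nonneg (by positivity), div_pow]
  rw [div_eq_mul_inv, show (2 : ℝ) ^ 2 = 4 by norm_num]
  refine mul_le_mul_of_nonneg_left (inv_anti₀ (by positivity) ?_) (by norm_num)
  exact pow_le_pow_left₀ (by positivity) (by linarith) 2

/-- Integration in spherical coordinates of a function with separated variables. -/
theorem integral_spherical {f : E3 → ℝ} (hf : Integrable f) {R Θ Φ : ℝ → ℝ} (hR : Continuous R)
    (hΘ : Continuous Θ) {C : ℝ} (hb : ∀ r θ, |R r * Θ θ| ≤ C * (2 / (r ^ 2 + 1)) ^ 3)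
    (hsep : ∀ r θ φ : ℝ, f !₂[r * sin θ * cos φ, r * sin θ * sin φ, r * cos θ] =
      R r * Θ θ * Φ φ) :
    ∫ x, f x = (∫ r in Set.Ioi 0, r ^ 2 * R r) * (∫ θ in 0..π, sin θ * Θ θ) *
      ∫ φ in -π..π, Φ φ := by
  have hC : 0 ≤ C := by
    have := (abs_nonneg _).trans (hb 0 0)
    norm_num at this
    linarith
  set g : ℝ × ℝ → ℝ := fun p => R (√(p.1 ^ 2 + p.2 ^ 2)) *
    Θ (arccos (p.1 / √(p.1 ^ 2 + p.2 ^ 2))) with hg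
  have hgm : Measurable g := by
    have h1 : Measurable fun p : ℝ × ℝ => √(p.1 ^ 2 + p.2 ^ 2) := by fun_prop
    exact (hR.measurable.comp h1).mul (hΘ.measurable.comp
      (continuous_arccos.measurable.comp (measurable_fst.div h1)))
  have hcyl : ∀ z ρ φ : ℝ, 0 < ρ → f !₂[ρ * cos φ, ρ * sin φ, z] = g (z, ρ) * Φ φ := by
    intro z ρ φ hρ
    have hr : 0 < √(z ^ 2 + ρ ^ 2) := Real.sqrt_pos.mpr (by positivity)
    have hr2 : √(z ^ 2 + ρ ^ 2) ^ 2 = z ^ 2 + ρ ^ 2 := Real.sq_sqrt (by positivity)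
    have hzr : |z / √(z ^ 2 + ρ ^ 2)| ≤ 1 := by
      rw [abs_div, abs_of_pos hr, div_le_one hr]
      exact Real.abs_le_sqrt (by nlinarith)
    have hcos : cos (arccos (z / √(z ^ 2 + ρ ^ 2))) = z / √(z ^ 2 + ρ ^ 2) :=
      Real.cos_arccos (neg_le_of_abs_le hzr) (le_of_abs_le hzr)
    have hsin : sin (arccos (z / √(z ^ 2 + ρ ^ 2))) = ρ / √(z ^ 2 + ρ ^ 2) := by
      rw [Real.sin_arccos, Real.sqrt_eq_iff_mul_self_eq (by
        rw [sub_nonneg, ← sq_abs]; exact pow_le_one₀ (abs_nonneg _) hzr) (by positivity)]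
      field_simp
      rw [hr2]
      ring
    rw [← hsep, hcos, hsin]
    congr 2
    field_simp
  have hstep : ∫ x, f x = ∫ z, ∫ q : ℝ × ℝ, f !₂[q.1, q.2, z] := by
    have hi : Integrable (fun p : ℝ × (ℝ × ℝ) => f (splitLast.symm p)) :=
      (measurePreserving_splitLast.symm splitLast).integrable_comp_emb
        splitLast.symm.measurableEmbedding |>.mpr hf
    rw [← (measurePreserving_splitLast.symm splitLast).integral_comp'
      (g := f), Measure.volume_eq_prod, integral_prod _ hi]
    exact integral_congr_ae (Eventually.of_forall fun z => integral_congr_ae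
      (Eventually.of_forall fun q => congrArg f (splitLast_symm_apply z q.1 q.2)))
  have hinner : ∀ z, ∫ q : ℝ × ℝ, f !₂[q.1, q.2, z] =
      (∫ ρ in Set.Ioi 0, ρ * g (z, ρ)) * ∫ φ in -π..π, Φ φ := fun z => by
    rw [← integral_comp_polarCoord_symm, polarCoord_target,
      intervalIntegral.integral_of_le (by linarith [pi_pos]), integral_Ioc_eq_integral_Ioo,
      ← setIntegral_prod_mul, Measure.volume_eq_prod]
    refine setIntegral_congr_fun (measurableSet_Ioi.prod measurableSet_Ioo) fun p hp => ?_
    simp only [polarCoord_symm_apply, smul_eq_mul]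
    rw [hcyl _ _ _ hp.1]
    ring
  have hplane : Integrable (fun p : ℝ × ℝ => (Set.Ioi (0 : ℝ)).indicator (fun ρ => ρ * g (p.1, ρ)) p.2) := by
    refine (integrable_plane_decay.const_mul C).mono' ?_ (Eventually.of_forall fun p => ?_)
    · refine Measurable.aestronglyMeasurable ?_
      have : (fun p : ℝ × ℝ => (Set.Ioi (0 : ℝ)).indicator (fun ρ => ρ * g (p.1, ρ)) p.2) =
          (Prod.snd ⁻¹' Set.Ioi (0 : ℝ)).indicator fun p => p.2 * g p := by
        ext p
        simp [Set.indicator]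
      rw [this]
      exact (measurable_snd.mul hgm).indicator (measurable_snd measurableSet_Ioi)
    · by_cases hp : p.2 ∈ Set.Ioi (0 : ℝ)
      · rw [Set.indicator_of_mem hp, norm_mul, Real.norm_of_nonneg (le_of_lt hp), Real.norm_eq_abs]
        have h1 := hb (√(p.1 ^ 2 + p.2 ^ 2)) (arccos (p.1 / √(p.1 ^ 2 + p.2 ^ 2)))
        rw [Real.sq_sqrt (by positivity)] at h1
        have hp' : 0 < p.2 := hp
        have h2 : p.2 * (2 / (p.1 ^ 2 + p.2 ^ 2 + 1)) ≤ 1 := by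
          rw [mul_div_assoc', div_le_one (by positivity)]
          nlinarith [sq_nonneg (p.2 - 1), sq_nonneg p.1]
        calc p.2 * |g p| ≤ p.2 * (C * (2 / (p.1 ^ 2 + p.2 ^ 2 + 1)) ^ 3) := by gcongr
          _ = C * (2 / (p.1 ^ 2 + p.2 ^ 2 + 1)) ^ 2 * (p.2 * (2 / (p.1 ^ 2 + p.2 ^ 2 + 1))) := by ring
          _ ≤ C * (2 / (p.1 ^ 2 + p.2 ^ 2 + 1)) ^ 2 * 1 := by gcongr
          _ = _ := mul_one _
      · rw [Set.indicator_of_notMem hp, norm_zero]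
        positivity
  have hpolar : ∫ z, ∫ ρ in Set.Ioi 0, ρ * g (z, ρ) =
      (∫ r in Set.Ioi 0, r ^ 2 * R r) * ∫ θ in 0..π, sin θ * Θ θ := by
    have hind : ∫ z, ∫ ρ in Set.Ioi 0, ρ * g (z, ρ) =
        ∫ z, ∫ ρ, (Set.Ioi (0 : ℝ)).indicator (fun ρ => ρ * g (z, ρ)) ρ := by
      simp_rw [integral_indicator (measurableSet_Ioi (a := (0 : ℝ)))]
    rw [hind, ← integral_prod _ hplane, ← Measure.volume_eq_prod, ← integral_comp_polarCoord_symm,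
      polarCoord_target]
    have hθ : ∫ θ in 0..π, sin θ * Θ θ =
        ∫ θ in Set.Ioo (-π) π, (Set.Ioi (0 : ℝ)).indicator (fun θ => sin θ * Θ θ) θ := by
      rw [intervalIntegral.integral_of_le pi_pos.le, integral_Ioc_eq_integral_Ioo,
        setIntegral_indicator measurableSet_Ioi]
      congr 2
      ext t
      simp only [Set.mem_Ioo, Set.mem_inter_iff, Set.mem_Ioi]
      constructor
      · rintro ⟨h1, h2⟩
        exact ⟨⟨by linarith [pi_pos], h2⟩, h1⟩
      · rintro ⟨⟨-, h2⟩, h1⟩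
        exact ⟨h1, h2⟩
    rw [hθ, ← setIntegral_prod_mul, Measure.volume_eq_prod]
    refine setIntegral_congr_fun (measurableSet_Ioi.prod measurableSet_Ioo) fun p hp => ?_
    obtain ⟨hr, hθ1, hθ2⟩ := hp
    have hr' : 0 < p.1 := hr
    simp only [polarCoord_symm_apply, smul_eq_mul]
    by_cases hpos : 0 < p.2
    · have hs := sin_pos_of_pos_of_lt_pi hpos hθ2
      have hrad : √((p.1 * cos p.2) ^ 2 + (p.1 * sin p.2) ^ 2) = p.1 := by
        rw [Real.sqrt_eq_iff_mul_self_eq (by positivity) hr'.le]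
        linear_combination (p.1 ^ 2) * sin_sq_add_cos_sq p.2
      rw [Set.indicator_of_mem (show p.2 ∈ Set.Ioi (0 : ℝ) from hpos),
        Set.indicator_of_mem (show p.1 * sin p.2 ∈ Set.Ioi (0 : ℝ) from mul_pos hr' hs)]
      simp only [hg, hrad]
      rw [mul_div_cancel_left₀ _ hr'.ne', arccos_cos hpos.le hθ2.le]
      ring
    · have hs := sin_nonpos_of_nonpos_of_neg_pi_le (not_lt.mp hpos) hθ1.le
      rw [Set.indicator_of_notMem (show p.2 ∉ Set.Ioi (0 : ℝ) from hpos),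
        Set.indicator_of_notMem (show p.1 * sin p.2 ∉ Set.Ioi (0 : ℝ) from
          not_lt.mpr (mul_nonpos_of_nonneg_of_nonpos hr'.le hs))]
      simp
  rw [hstep]
  simp_rw [hinner]
  rw [integral_mul_const, hpolar]

/-- Radial integrals over `ℝ³` as trigonometric integrals on `S³`. -/
theorem integral_radial (g : ℝ → ℝ) :
    ∫ r in Set.Ioi (0 : ℝ), 2 / (r ^ 2 + 1) * g (π - 2 * arctan r) = ∫ χ in 0..π, g χ := by
  have himg : (fun r : ℝ => π - 2 * arctan r) '' Set.Ioi 0 = Set.Ioo 0 π := by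
    ext t
    simp only [Set.mem_image, Set.mem_Ioi, Set.mem_Ioo]
    constructor
    · rintro ⟨r, hr, rfl⟩
      have h1 := arctan_pos.mpr hr
      have h2 := arctan_lt_pi_div_two r
      constructor <;> linarith
    · rintro ⟨h1, h2⟩
      refine ⟨tan ((π - t) / 2), tan_pos_of_pos_of_lt_pi_div_two (by linarith) (by linarith), ?_⟩
      rw [arctan_tan (by linarith) (by linarith)]
      ring
  rw [intervalIntegral.integral_of_le pi_pos.le, integral_Ioc_eq_integral_Ioo, ← himg,
    integral_image_eq_integral_abs_deriv_smul (f' := fun r => -(2 * (1 / (1 + r ^ 2))))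
      measurableSet_Ioi (fun r _ => (((hasDerivAt_arctan r).const_mul 2).const_sub π).hasDerivWithinAt)
      (fun a _ b _ hab => arctan_injective (by linarith [show π - 2 * arctan a = π - 2 * arctan b from hab]))]
  refine setIntegral_congr_fun measurableSet_Ioi fun r _ => ?_
  simp only [smul_eq_mul]
  rw [abs_neg, abs_of_pos (by positivity)]
  congr 1
  field_simp
  ring

theorem sin_radial (r : ℝ) : sin (π - 2 * arctan r) = 2 / (r ^ 2 + 1) * r := by
  have h : √(1 + r ^ 2) * √(1 + r ^ 2) = 1 + r ^ 2 := Real.mul_self_sqrt (by positivity)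
  have h0 : 0 < √(1 + r ^ 2) := Real.sqrt_pos.mpr (by positivity)
  rw [sin_pi_sub, sin_two_mul, sin_arctan, cos_arctan]
  field_simp
  linear_combination (-r) * h

theorem cos_radial (r : ℝ) : cos (π - 2 * arctan r) = 1 - 2 / (r ^ 2 + 1) := by
  rw [cos_pi_sub, cos_two_mul, cos_sq_arctan]
  field_simp
  ring

theorem exists_bound_eval_cos (p : Polynomial ℝ) : ∃ B, ∀ t, |p.eval (cos t)| ≤ B := by
  obtain ⟨B, hB⟩ := (isCompact_Icc (a := (-1 : ℝ)) (b := 1)).exists_bound_of_continuousOn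
    p.continuous.continuousOn
  exact ⟨B, fun t => hB _ ⟨neg_one_le_cos t, cos_le_one t⟩⟩

theorem cfac_polar (r θ φ : ℝ) :
    cfac !₂[r * sin θ * cos φ, r * sin θ * sin φ, r * cos θ] = 2 / (r ^ 2 + 1) := by
  rw [cfac, E3_norm_sq]
  congr 2
  simp only [Matrix.cons_val]
  linear_combination r ^ 2 * sin θ ^ 2 * sin_sq_add_cos_sq φ + r ^ 2 * sin_sq_add_cos_sq θ

theorem stereo_polar_sphHarm {α : ℕ × ℕ × ℤ} (hα : memLam α) (r θ φ : ℝ) :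
    sphHarm α (stereo !₂[r * sin θ * cos φ, r * sin θ * sin φ, r * cos θ]) =
      1 / √(akl α.1 α.2.1) * solidConst α.2.1 α.2.2.natAbs *
        ((2 / (r ^ 2 + 1) * r) ^ α.2.1 *
          (chebPoly (α.1 + 1) (α.2.1 + 1)).eval (1 - 2 / (r ^ 2 + 1))) *
        (sin θ ^ α.2.2.natAbs * (legPoly α.2.1 α.2.2.natAbs).eval (cos θ)) * ymfun α.2.2 φ := by
  rw [sphHarm, stereo, cfac_polar, solid_polar hα.2 (r := 2 / (r ^ 2 + 1) * r) (θ := θ) (φ := φ)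
    (by simp; ring) (by simp; ring) (by simp; ring)]
  ring

theorem continuous_sphHarm_stereo (α : ℕ × ℕ × ℤ) : Continuous fun x => sphHarm α (stereo x) :=
  (contDiff_sphHarm α).continuous.comp contDiff_stereo.continuous

theorem integrable_sphHarm_mul (α β : ℕ × ℕ × ℤ) :
    Integrable fun x => cfac x ^ 3 * (sphHarm α (stereo x) * sphHarm β (stereo x)) := by
  obtain ⟨C, hC, h⟩ := exists_bound_sphHarm α
  obtain ⟨D, hD, h'⟩ := exists_bound_sphHarm β
  refine (integrable_cfac_cube.mul_const (C * D)).mono'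
    ((continuous_cfac.pow 3).mul ((continuous_sphHarm_stereo α).mul
      (continuous_sphHarm_stereo β))).aestronglyMeasurable (Eventually.of_forall fun x => ?_)
  have hw := cfac_pos x
  rw [norm_mul, norm_mul, Real.norm_of_nonneg (by positivity)]
  gcongr
  · exact (h _ (stereo_mem x)).1
  · exact (h' _ (stereo_mem x)).1

theorem solidConst_sq_mul {l m : ℕ} (h : m ≤ l) :
    solidConst l m ^ 2 * trigMoment (2 * m + 1) (legPoly l m) (legPoly l m) * π = 1 := by
  have hT := trigMoment_legPoly_self h
  have hpi := pi_pos
  have h1 : (0 : ℝ) < (l - m).factorial := by positivity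
  have h2 : (0 : ℝ) < (l + m).factorial := by positivity
  rw [solidConst, div_pow, mul_pow, Real.sq_sqrt (by positivity), Real.sq_sqrt (by positivity)]
  field_simp
  linear_combination hT

theorem integral_sphHarm_mul {α β : ℕ × ℕ × ℤ} (hα : memLam α) (hβ : memLam β) :
    ∫ x, cfac x ^ 3 * (sphHarm α (stereo x) * sphHarm β (stereo x)) = if α = β then 1 else 0 := by
  obtain ⟨k, l, m⟩ := α
  obtain ⟨k', l', m'⟩ := β
  set τ := chebPoly (k + 1) (l + 1) with hτ
  set τ' := chebPoly (k' + 1) (l' + 1) with hτ'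
  set q := legPoly l m.natAbs with hq
  set q' := legPoly l' m'.natAbs with hq'
  have hwc : Continuous fun r : ℝ => 2 / (r ^ 2 + 1) :=
    continuous_const.div (by fun_prop) fun r => by positivity
  obtain ⟨B, hB⟩ := exists_bound_eval_cos (τ * τ')
  obtain ⟨B', hB'⟩ := exists_bound_eval_cos (q * q')
  have hB0 : 0 ≤ B := (abs_nonneg _).trans (hB 0)
  have hsep := integral_spherical (integrable_sphHarm_mul (k, l, m) (k', l', m'))
    (R := fun r => (2 / (r ^ 2 + 1)) ^ 3 * ((2 / (r ^ 2 + 1) * r) ^ (l + l') *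
      (τ * τ').eval (1 - 2 / (r ^ 2 + 1))))
    (Θ := fun θ => sin θ ^ (m.natAbs + m'.natAbs) * (q * q').eval (cos θ))
    (Φ := fun φ => (1 / √(akl k l) * solidConst l m.natAbs) *
      (1 / √(akl k' l') * solidConst l' m'.natAbs) * (ymfun m φ * ymfun m' φ))
    (C := B * B')
    ((hwc.pow 3).mul (((hwc.mul continuous_id).pow _).mul
      ((τ * τ').continuous.comp (continuous_const.sub hwc))))
    ((continuous_sin.pow _).mul (continuous_eval_cos _))
    (fun r θ => by
      have h1 : |(2 / (r ^ 2 + 1) * r) ^ (l + l')| ≤ 1 := by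
        rw [← sin_radial, abs_pow]
        exact pow_le_one₀ (abs_nonneg _) (abs_sin_le_one _)
      have h2 : |sin θ ^ (m.natAbs + m'.natAbs)| ≤ 1 := by
        rw [abs_pow]
        exact pow_le_one₀ (abs_nonneg _) (abs_sin_le_one _)
      have h3 := hB (π - 2 * arctan r)
      rw [cos_radial] at h3
      have h4 := hB' θ
      rw [abs_mul, abs_mul, abs_mul, abs_mul, abs_of_nonneg (a := (2 / (r ^ 2 + 1)) ^ 3) (by positivity)]
      calc _ ≤ (2 / (r ^ 2 + 1)) ^ 3 * (1 * B) * (1 * B') := by gcongr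
        _ = _ := by ring)
    (fun r θ φ => by
      rw [cfac_polar, stereo_polar_sphHarm hα, stereo_polar_sphHarm hβ]
      simp only [Polynomial.eval_mul, pow_add]
      ring)
  rw [hsep]
  have hrad : ∫ r in Set.Ioi (0 : ℝ), r ^ 2 * ((2 / (r ^ 2 + 1)) ^ 3 * ((2 / (r ^ 2 + 1) * r) ^ (l + l') *
      (τ * τ').eval (1 - 2 / (r ^ 2 + 1)))) = trigMoment (l + l' + 2) τ τ' := by
    rw [trigMoment, ← integral_radial]
    refine setIntegral_congr_fun measurableSet_Ioi fun r _ => ?_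
    simp only [sin_radial, cos_radial, Polynomial.eval_mul, pow_add]
    ring
  have hang : ∫ θ in 0..π, sin θ * (sin θ ^ (m.natAbs + m'.natAbs) * (q * q').eval (cos θ)) =
      trigMoment (m.natAbs + m'.natAbs + 1) q q' := by
    rw [trigMoment]
    refine intervalIntegral.integral_congr fun θ _ => ?_
    simp only [Polynomial.eval_mul, pow_succ]
    ring
  rw [hrad, hang, intervalIntegral.integral_const_mul, integral_ymfun_mul]
  by_cases hm : m = m'
  · subst hm
    rw [if_pos rfl, show m.natAbs + m.natAbs + 1 = 2 * m.natAbs + 1 by ring]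
    by_cases hl : l = l'
    · subst hl
      have hnorm := solidConst_sq_mul hα.2
      simp only at hnorm
      rw [← hq] at hnorm
      rw [show l + l + 2 = 2 * l + 2 by ring]
      by_cases hk : k = k'
      · subst hk
        have hakl : 0 < akl k l := by
          have := pi_pos
          unfold akl
          positivity
        have hs : √(akl k l) ^ 2 = akl k l := Real.sq_sqrt hakl.le
        have hs0 : 0 < √(akl k l) := Real.sqrt_pos.mpr hakl
        have hT := trigMoment_chebPoly_akl hα.1
        simp only at hT
        rw [if_pos rfl, hτ', hT, hq', ← hq]
        generalize √(akl k l) = a at hs hs0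
        rw [← hs]
        field_simp
        linear_combination hnorm
      · rw [hτ, hτ', trigMoment_chebPoly_of_ne hk, if_neg (by simp [hk])]
        ring
    · rw [hq, hq', trigMoment_legPoly_of_ne hl, if_neg (by simp [hl])]
      ring
  · rw [if_neg hm, if_neg (by simp [hm])]
    ring

theorem integral_Wfun_mul {α β : ℕ × ℕ × ℤ} (hα : memLam α) (hβ : memLam β) :
    ∫ x, cfac x ^ 2 * (Wfun α x * Wfun β x) = if α = β then 1 else 0 := by
  rw [← integral_sphHarm_mul hα hβ]
  refine integral_congr_ae (Eventually.of_forall fun x => ?_)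
  simp only [Wfun_eq hα, Wfun_eq hβ]
  linear_combination cfac x ^ 2 * (sphHarm α (stereo x) * sphHarm β (stereo x)) *
    Real.sq_sqrt (cfac_pos x).le

theorem integral_inner_gradient_Wfun {α β : ℕ × ℕ × ℤ} (hα : memLam α) (hβ : memLam β) :
    ∫ x, ⟪gradient (Wfun α) x, gradient (Wfun β) x⟫ = if α = β then eigval α.1 else 0 := by
  rw [(memW10_Wfun hα).green hβ, integral_Wfun_mul hα hβ]
  by_cases h : α = β
  · rw [if_pos h, if_pos h, h, mul_one]
  · rw [if_neg h, if_neg h, mul_zero]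

/-! ### Polynomials on the three-sphere are combinations of the spherical harmonics -/

instance : CompactSpace sph3 := isCompact_iff_compactSpace.mp isCompact_sph3

/-- The restriction of `sphHarm α` to the sphere. -/
def sphHarmC (α : ℕ × ℕ × ℤ) : C(sph3, ℝ) :=
  ⟨fun p => sphHarm α p, (contDiff_sphHarm α).continuous.comp continuous_subtype_val⟩

/-- The restriction of a solid harmonic to the sphere. -/
def solidC (l : ℕ) (m : ℤ) : C(sph3, ℝ) :=
  ⟨fun p => solid l m p.1.1,
    (contDiff_solid l m).continuous.comp (continuous_fst.comp continuous_subtype_val)⟩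

/-- The restriction to the sphere of the last coordinate of `ℝ³ × ℝ`. -/
def coordT : C(sph3, ℝ) := ⟨fun p => p.1.2, continuous_snd.comp continuous_subtype_val⟩

/-- The restriction to the sphere of a coordinate of the factor `ℝ³` of `ℝ³ × ℝ`. -/
def coordX (i : Fin 3) : C(sph3, ℝ) :=
  ⟨fun p => p.1.1 i, by fun_prop⟩

/-- The restriction to the sphere of `azim m`. -/
def azimC (m : ℤ) : C(sph3, ℝ) :=
  ⟨fun p => azim m (p.1.1 0) (p.1.1 1),
    (contDiff_azim m).continuous.comp (continuous_fst.comp continuous_subtype_val)⟩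

/-- The linear span of the spherical harmonics on the sphere. -/
def harmSpan : Submodule ℝ C(sph3, ℝ) :=
  Submodule.span ℝ (Set.range fun α : {α // memLam α} => sphHarmC α)

theorem akl_pos (k l : ℕ) : 0 < akl k l := by
  have := pi_pos
  unfold akl
  positivity

theorem degree_chebPoly (n d : ℕ) : (chebPoly (n + d) d).degree = n := by
  have hdeg : (Polynomial.Chebyshev.T ℝ ((n + d : ℕ) : ℤ)).natDegree = n + d := by
    rw [Polynomial.Chebyshev.natDegree_T, Int.natAbs_natCast]
  refine Polynomial.degree_eq_of_le_of_coeff_ne_zero ?_ ?_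
  · refine Polynomial.degree_le_of_natDegree_le ?_
    have := Polynomial.natDegree_iterate_derivative
      (Polynomial.Chebyshev.T ℝ ((n + d : ℕ) : ℤ)) d
    rw [chebPoly]
    omega
  · have hne : Polynomial.Chebyshev.T ℝ ((n + d : ℕ) : ℤ) ≠ 0 := by
      rw [← Polynomial.leadingCoeff_ne_zero, Polynomial.Chebyshev.leadingCoeff_T]
      positivity
    have h1 : (Polynomial.Chebyshev.T ℝ ((n + d : ℕ) : ℤ)).coeff (n + d) ≠ 0 := by
      rw [← Polynomial.leadingCoeff_ne_zero, Polynomial.leadingCoeff, hdeg] at hne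
      exact hne
    have h2 : (n + d).descFactorial d ≠ 0 := by
      rw [Ne, Nat.descFactorial_eq_zero_iff_lt]
      omega
    rw [chebPoly, Polynomial.coeff_iterate_derivative, nsmul_eq_mul]
    exact mul_ne_zero (Nat.cast_ne_zero.mpr h2) h1

theorem aeval_mul_solidC_mem {l : ℕ} {m : ℤ} (hm : m.natAbs ≤ l) (p : Polynomial ℝ) :
    Polynomial.aeval coordT p * solidC l m ∈ harmSpan := by
  let S : Polynomial.Sequence ℝ :=
    ⟨fun n => chebPoly (n + (l + 1)) (l + 1), fun n => degree_chebPoly n (l + 1)⟩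
  have hp : p ∈ Submodule.span ℝ (Set.range S) := by
    rw [S.span fun i => (Polynomial.leadingCoeff_ne_zero.mpr (S.ne_zero i)).isUnit]
    trivial
  induction hp using Submodule.span_induction with
  | mem q hq =>
    obtain ⟨n, rfl⟩ := hq
    have hmem : sphHarmC (n + l, l, m) ∈ harmSpan :=
      Submodule.subset_span ⟨⟨(n + l, l, m), Nat.le_add_left l n, hm⟩, rfl⟩
    have hpos : 0 < √(akl (n + l) l) := Real.sqrt_pos.mpr (akl_pos _ _)
    convert harmSpan.smul_mem (√(akl (n + l) l)) hmem using 1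
    ext x
    simp only [ContinuousMap.mul_apply, Polynomial.aeval_continuousMap_apply,
      ContinuousMap.smul_apply, smul_eq_mul]
    change Polynomial.aeval x.1.2 (chebPoly (n + (l + 1)) (l + 1)) * solid l m x.1.1 =
      √(akl (n + l) l) * ((1 / √(akl (n + l) l)) *
        (chebPoly (n + l + 1) (l + 1)).eval x.1.2 * solid l m x.1.1)
    rw [Polynomial.coe_aeval_eq_eval, ← add_assoc]
    field_simp
  | zero => simp
  | add q r _ _ hq hr =>
    rw [map_add, add_mul]
    exact harmSpan.add_mem hq hr
  | smul c q _ hq =>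
    rw [map_smul, smul_mul_assoc]
    exact harmSpan.smul_mem c hq

theorem solidC_eq (j : ℕ) (m : ℤ) :
    solidC (m.natAbs + j) m = solidConst (m.natAbs + j) m.natAbs • (azimC m *
      ∑ i ∈ Finset.range (j + 1), (legPoly (m.natAbs + j) m.natAbs).coeff i •
        (coordX 2 ^ i * (1 - coordT ^ 2) ^ ((j - i) / 2))) := by
  ext p
  have hp : ‖p.1.1‖ ^ 2 = 1 - p.1.2 ^ 2 := eq_sub_of_add_eq p.2
  simp only [ContinuousMap.smul_apply, ContinuousMap.mul_apply, ContinuousMap.sum_apply,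
    ContinuousMap.pow_apply, ContinuousMap.sub_apply, ContinuousMap.one_apply, smul_eq_mul]
  change solid (m.natAbs + j) m p.1.1 = solidConst (m.natAbs + j) m.natAbs *
    (azim m (p.1.1 0) (p.1.1 1) * ∑ i ∈ Finset.range (j + 1),
      (legPoly (m.natAbs + j) m.natAbs).coeff i * (p.1.1 2 ^ i * (1 - p.1.2 ^ 2) ^ ((j - i) / 2)))
  rw [solid, polyHom, Nat.add_sub_cancel_left, hp, mul_assoc]
  simp only [mul_assoc]

theorem aeval_mul_azimC_mem (m : ℤ) (j : ℕ) (p : Polynomial ℝ) :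
    Polynomial.aeval coordT p * (azimC m * coordX 2 ^ j) ∈ harmSpan := by
  induction j using Nat.strong_induction_on generalizing p with
  | _ j ih =>
    have h := aeval_mul_solidC_mem (Nat.le_add_right m.natAbs j) p
    set q := legPoly (m.natAbs + j) m.natAbs with hq
    have hc := solidConst_pos (m.natAbs + j) m.natAbs
    have hq0 : q.coeff j ≠ 0 := by
      simpa using coeff_legPoly_top (Nat.le_add_right m.natAbs j)
    rw [solidC_eq, mul_smul_comm, Submodule.smul_mem_iff _ hc.ne', Finset.sum_range_succ, mul_add,
      mul_add, Finset.mul_sum, Finset.mul_sum, Submodule.add_mem_iff_right] at h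
    · rw [Nat.sub_self, Nat.zero_div, pow_zero, mul_one, mul_smul_comm, mul_smul_comm,
        Submodule.smul_mem_iff _ hq0] at h
      exact h
    · refine Submodule.sum_mem _ fun i hi => ?_
      have := harmSpan.smul_mem (q.coeff i) (ih i (Finset.mem_range.mp hi)
        (p * (1 - Polynomial.X ^ 2) ^ ((j - i) / 2)))
      convert this using 1
      simp only [map_mul, map_pow, map_sub, map_one, Polynomial.aeval_X, mul_smul_comm]
      congr 1
      ring

/-- The function `(x + i y) ^ n` on the sphere. -/
def planePow (n : ℕ) (p : sph3) : ℂ := ((p.1.1 0 : ℂ) + p.1.1 1 * Complex.I) ^ n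

theorem continuous_planePow (n : ℕ) : Continuous (planePow n) := by
  unfold planePow
  fun_prop

/-- The real part of `(x + i y) ^ n` on the sphere. -/
def planeRe (n : ℕ) : C(sph3, ℝ) :=
  ⟨fun p => (planePow n p).re, Complex.continuous_re.comp (continuous_planePow n)⟩

/-- The imaginary part of `(x + i y) ^ n` on the sphere. -/
def planeIm (n : ℕ) : C(sph3, ℝ) :=
  ⟨fun p => (planePow n p).im, Complex.continuous_im.comp (continuous_planePow n)⟩

theorem planeRe_zero : planeRe 0 = 1 := by
  ext p
  simp [planeRe, planePow]

theorem planeIm_zero : planeIm 0 = 0 := by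
  ext p
  simp [planeIm, planePow]

theorem planeRe_succ (n : ℕ) :
    planeRe (n + 1) = coordX 0 * planeRe n - coordX 1 * planeIm n := by
  ext p
  simp [planeRe, planeIm, planePow, pow_succ', coordX]

theorem planeIm_succ (n : ℕ) :
    planeIm (n + 1) = coordX 0 * planeIm n + coordX 1 * planeRe n := by
  ext p
  simp [planeRe, planeIm, planePow, pow_succ', coordX]

theorem coord_sq_add :
    coordX 0 ^ 2 + coordX 1 ^ 2 + coordX 2 ^ 2 + coordT ^ 2 = 1 := by
  ext p
  have hp : ‖p.1.1‖ ^ 2 + p.1.2 ^ 2 = 1 := p.2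
  rw [E3_norm_sq] at hp
  exact hp

theorem planeRe_mem (a b n : ℕ) : coordT ^ a * coordX 2 ^ b * planeRe n ∈ harmSpan := by
  rcases Nat.eq_zero_or_pos n with rfl | hn
  · have h := harmSpan.smul_mem (√2) (aeval_mul_azimC_mem 0 b (Polynomial.X ^ a))
    convert h using 1
    rw [planeRe_zero]
    ext p
    simp [azimC, azim]
    field_simp
  · convert aeval_mul_azimC_mem n b (Polynomial.X ^ a) using 1
    have : azimC n = planeRe n := by
      ext p
      simp [azimC, azim, planeRe, planePow, hn, hn.ne']
    rw [this, map_pow, Polynomial.aeval_X]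
    ring

theorem planeIm_mem (a b n : ℕ) : coordT ^ a * coordX 2 ^ b * planeIm n ∈ harmSpan := by
  rcases Nat.eq_zero_or_pos n with rfl | hn
  · rw [planeIm_zero, mul_zero]
    exact harmSpan.zero_mem
  · convert aeval_mul_azimC_mem (-n) b (Polynomial.X ^ a) using 1
    have : azimC (-n) = planeIm n := by
      ext p
      simp [azimC, azim, planeIm, planePow, hn.ne']
    rw [this, map_pow, Polynomial.aeval_X]
    ring

/-- The span of the functions `t ^ a * z ^ b * Re (x + i y) ^ n`, `t ^ a * z ^ b * Im (x + i y) ^ n`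
on the sphere. -/
def planeSpan : Submodule ℝ C(sph3, ℝ) :=
  Submodule.span ℝ {f | ∃ a b n : ℕ, f = coordT ^ a * coordX 2 ^ b * planeRe n ∨
    f = coordT ^ a * coordX 2 ^ b * planeIm n}

theorem planeRe_mem_planeSpan (a b n : ℕ) :
    coordT ^ a * coordX 2 ^ b * planeRe n ∈ planeSpan :=
  Submodule.subset_span ⟨a, b, n, Or.inl rfl⟩

theorem planeIm_mem_planeSpan (a b n : ℕ) :
    coordT ^ a * coordX 2 ^ b * planeIm n ∈ planeSpan :=
  Submodule.subset_span ⟨a, b, n, Or.inr rfl⟩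

theorem planeSpan_le : planeSpan ≤ harmSpan := by
  refine Submodule.span_le.mpr ?_
  rintro f ⟨a, b, n, rfl | rfl⟩
  · exact planeRe_mem a b n
  · exact planeIm_mem a b n

theorem mul_mem_planeSpan {g : C(sph3, ℝ)}
    (hRe : ∀ a b n, coordT ^ a * coordX 2 ^ b * (g * planeRe n) ∈ planeSpan)
    (hIm : ∀ a b n, coordT ^ a * coordX 2 ^ b * (g * planeIm n) ∈ planeSpan)
    {f : C(sph3, ℝ)} (hf : f ∈ planeSpan) : g * f ∈ planeSpan := by
  induction hf using Submodule.span_induction with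
  | mem f hf =>
    obtain ⟨a, b, n, rfl | rfl⟩ := hf
    · rw [mul_left_comm]
      exact hRe a b n
    · rw [mul_left_comm]
      exact hIm a b n
  | zero => simp
  | add f f' _ _ h h' =>
    rw [mul_add]
    exact planeSpan.add_mem h h'
  | smul c f _ h =>
    rw [mul_smul_comm]
    exact planeSpan.smul_mem c h

theorem coordT_mul_mem {f : C(sph3, ℝ)} (hf : f ∈ planeSpan) : coordT * f ∈ planeSpan :=
  mul_mem_planeSpan
    (fun a b n => by convert planeRe_mem_planeSpan (a + 1) b n using 1; ring)
    (fun a b n => by convert planeIm_mem_planeSpan (a + 1) b n using 1; ring) hf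

theorem coordX_two_mul_mem {f : C(sph3, ℝ)} (hf : f ∈ planeSpan) : coordX 2 * f ∈ planeSpan :=
  mul_mem_planeSpan
    (fun a b n => by convert planeRe_mem_planeSpan a (b + 1) n using 1; ring)
    (fun a b n => by convert planeIm_mem_planeSpan a (b + 1) n using 1; ring) hf

theorem pow_mul_mem {f : C(sph3, ℝ)} (a b : ℕ) (hf : f ∈ planeSpan) :
    coordT ^ a * coordX 2 ^ b * f ∈ planeSpan := by
  induction a with
  | zero =>
    induction b with
    | zero => simpa using hf
    | succ b ih =>
      convert coordX_two_mul_mem ih using 1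
      ring
  | succ a ih =>
    convert coordT_mul_mem ih using 1
    ring

theorem planeSpan_of_two_nsmul {f : C(sph3, ℝ)} (h : f + f ∈ planeSpan) : f ∈ planeSpan := by
  have := planeSpan.smul_mem (1 / 2 : ℝ) h
  rwa [← two_smul ℝ f, smul_smul, show (1 / 2 : ℝ) * 2 = 1 by norm_num, one_smul] at this

theorem rho_mul_mem {f : C(sph3, ℝ)} (hf : f ∈ planeSpan) :
    (coordX 0 ^ 2 + coordX 1 ^ 2) * f ∈ planeSpan := by
  have h := planeSpan.sub_mem (planeSpan.sub_mem hf (coordT_mul_mem (coordT_mul_mem hf)))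
    (coordX_two_mul_mem (coordX_two_mul_mem hf))
  convert h using 1
  linear_combination f * coord_sq_add

theorem planeRe_mem' (n : ℕ) : planeRe n ∈ planeSpan := by
  simpa using planeRe_mem_planeSpan 0 0 n

theorem planeIm_mem' (n : ℕ) : planeIm n ∈ planeSpan := by
  simpa using planeIm_mem_planeSpan 0 0 n

theorem coordX_zero_mul_planeRe (n : ℕ) : coordX 0 * planeRe n ∈ planeSpan := by
  rcases n with _ | n
  · convert planeRe_mem' 1 using 1
    rw [planeRe_succ, planeRe_zero, planeIm_zero]
    ring
  · refine planeSpan_of_two_nsmul ?_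
    convert planeSpan.add_mem (planeRe_mem' (n + 2)) (rho_mul_mem (planeRe_mem' n)) using 1
    rw [planeRe_succ (n + 1), planeIm_succ, planeRe_succ]
    ring

theorem coordX_zero_mul_planeIm (n : ℕ) : coordX 0 * planeIm n ∈ planeSpan := by
  rcases n with _ | n
  · rw [planeIm_zero, mul_zero]
    exact planeSpan.zero_mem
  · refine planeSpan_of_two_nsmul ?_
    convert planeSpan.add_mem (planeIm_mem' (n + 2)) (rho_mul_mem (planeIm_mem' n)) using 1
    rw [planeIm_succ (n + 1), planeRe_succ, planeIm_succ]
    ring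

theorem coordX_zero_mul_mem {f : C(sph3, ℝ)} (hf : f ∈ planeSpan) : coordX 0 * f ∈ planeSpan :=
  mul_mem_planeSpan (fun a b n => pow_mul_mem a b (coordX_zero_mul_planeRe n))
    (fun a b n => pow_mul_mem a b (coordX_zero_mul_planeIm n)) hf

theorem coordX_one_mul_mem {f : C(sph3, ℝ)} (hf : f ∈ planeSpan) : coordX 1 * f ∈ planeSpan := by
  refine mul_mem_planeSpan (fun a b n => pow_mul_mem a b ?_) (fun a b n => pow_mul_mem a b ?_) hf
  · convert planeSpan.sub_mem (planeIm_mem' (n + 1)) (coordX_zero_mul_planeIm n) using 1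
    rw [planeIm_succ]
    ring
  · convert planeSpan.sub_mem (coordX_zero_mul_planeRe n) (planeRe_mem' (n + 1)) using 1
    rw [planeRe_succ]
    ring

/-- The algebra of polynomial functions on the sphere. -/
def polyAlg : Subalgebra ℝ C(sph3, ℝ) :=
  Algebra.adjoin ℝ {coordX 0, coordX 1, coordX 2, coordT}

theorem polyAlg_le : Subalgebra.toSubmodule polyAlg ≤ harmSpan := by
  refine le_trans (fun g hg => ?_) planeSpan_le
  have key : ∀ f ∈ planeSpan, g * f ∈ planeSpan := by
    replace hg : g ∈ Algebra.adjoin ℝ {coordX 0, coordX 1, coordX 2, coordT} := hg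
    induction hg using Algebra.adjoin_induction with
    | mem g hg =>
      intro f hf
      rcases hg with rfl | rfl | rfl | rfl
      · exact coordX_zero_mul_mem hf
      · exact coordX_one_mul_mem hf
      · exact coordX_two_mul_mem hf
      · exact coordT_mul_mem hf
    | algebraMap r =>
      intro f hf
      rw [← Algebra.smul_def]
      exact planeSpan.smul_mem r hf
    | add g h _ _ hg hh =>
      intro f hf
      rw [add_mul]
      exact planeSpan.add_mem (hg f hf) (hh f hf)
    | mul g h _ _ hg hh =>
      intro f hf
      rw [mul_assoc]
      exact hg _ (hh f hf)
  simpa [planeRe_zero] using key _ (planeRe_mem' 0)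

theorem polyAlg_separatesPoints : polyAlg.SeparatesPoints := by
  intro p q hpq
  by_contra hcon
  have key : ∀ f ∈ polyAlg, f p = f q := by
    intro f hf
    by_contra h
    exact hcon ⟨f, ⟨f, hf, rfl⟩, h⟩
  have hX : ∀ i : Fin 3, coordX i ∈ polyAlg := by
    intro i
    fin_cases i <;> exact Algebra.subset_adjoin (by simp)
  refine hpq (Subtype.ext (Prod.ext (PiLp.ext fun i => key _ (hX i)) (key coordT ?_)))
  exact Algebra.subset_adjoin (by simp)

theorem harmSpan_dense : harmSpan.topologicalClosure = ⊤ := by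
  have h := ContinuousMap.subalgebra_topologicalClosure_eq_top_of_separatesPoints polyAlg
    polyAlg_separatesPoints
  rw [eq_top_iff]
  intro f _
  have hf : f ∈ polyAlg.topologicalClosure := by
    rw [h]
    trivial
  exact Submodule.topologicalClosure_mono polyAlg_le hf

/-! ### Parseval's identity for the weight `cfac²` -/

/-- The inverse stereographic projection, as a map into the sphere. -/
def stereoS (x : E3) : sph3 := ⟨stereo x, stereo_mem x⟩

theorem measurableEmbedding_stereoS : MeasurableEmbedding stereoS := by
  refine Continuous.measurableEmbedding (contDiff_stereo.continuous.subtype_mk _) fun x y hxy => ?_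
  have h : stereo x = stereo y := congrArg Subtype.val hxy
  obtain ⟨h1, h2⟩ := Prod.ext_iff.mp h
  have hc : cfac x = cfac y := by
    have h2 : 1 - cfac x = 1 - cfac y := h2
    linarith
  have h1 : cfac x • x = cfac y • y := h1
  rw [← hc] at h1
  exact smul_right_injective E3 (cfac_pos x).ne' h1

/-- The surface measure of the sphere, in the stereographic chart. -/
def sphMeasure : Measure sph3 :=
  (volume.withDensity fun x : E3 => ENNReal.ofReal (cfac x ^ 3)).map stereoS

instance : IsFiniteMeasure sphMeasure := by
  have := isFiniteMeasure_withDensity_ofReal integrable_cfac_cube.2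
  unfold sphMeasure
  infer_instance

theorem measurable_density : Measurable fun x : E3 => ENNReal.ofReal (cfac x ^ 3) :=
  (continuous_cfac.pow 3).measurable.ennreal_ofReal

theorem integral_sphMeasure (f : sph3 → ℝ) :
    ∫ p, f p ∂sphMeasure = ∫ x, cfac x ^ 3 * f (stereoS x) := by
  rw [sphMeasure, measurableEmbedding_stereoS.integral_map,
    integral_withDensity_eq_integral_toReal_smul measurable_density (by simp)]
  refine integral_congr_ae (Eventually.of_forall fun x => ?_)
  have := cfac_pos x
  simp only [smul_eq_mul]
  rw [ENNReal.toReal_ofReal (by positivity)]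

theorem integrable_sphMeasure_iff (f : sph3 → ℝ) :
    Integrable f sphMeasure ↔ Integrable fun x => cfac x ^ 3 * f (stereoS x) := by
  rw [sphMeasure, measurableEmbedding_stereoS.integrable_map_iff,
    integrable_withDensity_iff_integrable_smul' measurable_density (by simp)]
  refine integrable_congr (Eventually.of_forall fun x => ?_)
  have := cfac_pos x
  simp only [smul_eq_mul, Function.comp_apply]
  rw [ENNReal.toReal_ofReal (by positivity)]

/-- The function on the sphere corresponding to a function on `ℝ³`. -/
def toSphere (u : E3 → ℝ) : sph3 → ℝ :=
  Function.extend stereoS (fun x => u x / √(cfac x)) 0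

theorem toSphere_stereoS (u : E3 → ℝ) (x : E3) : toSphere u (stereoS x) = u x / √(cfac x) :=
  measurableEmbedding_stereoS.injective.extend_apply _ _ x

theorem memLp_toSphere {u : E3 → ℝ} (hu : AEStronglyMeasurable u)
    (hu2 : Integrable fun x => cfac x ^ 2 * u x ^ 2) : MemLp (toSphere u) 2 sphMeasure := by
  have hm : AEStronglyMeasurable (toSphere u) sphMeasure := by
    rw [sphMeasure, measurableEmbedding_stereoS.aestronglyMeasurable_map_iff]
    refine AEStronglyMeasurable.mono_ac (withDensity_absolutelyContinuous _ _) ?_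
    have : toSphere u ∘ stereoS = fun x => u x * (√(cfac x))⁻¹ := by
      ext x
      rw [Function.comp_apply, toSphere_stereoS, div_eq_mul_inv]
    rw [this]
    refine hu.mul (Continuous.aestronglyMeasurable ?_)
    exact continuous_cfac.sqrt.inv₀ fun x => (Real.sqrt_pos.mpr (cfac_pos x)).ne'
  rw [memLp_two_iff_integrable_sq hm, integrable_sphMeasure_iff]
  refine hu2.congr (Eventually.of_forall fun x => ?_)
  have := cfac_pos x
  simp only [toSphere_stereoS]
  rw [div_pow, Real.sq_sqrt this.le]
  field_simp

theorem inner_toLp_sphMeasure {f g : sph3 → ℝ} (hf : MemLp f 2 sphMeasure)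
    (hg : MemLp g 2 sphMeasure) :
    ⟪hf.toLp f, hg.toLp g⟫ = ∫ x, cfac x ^ 3 * (f (stereoS x) * g (stereoS x)) := by
  rw [L2.inner_def, ← integral_sphMeasure fun p => f p * g p]
  refine integral_congr_ae ?_
  filter_upwards [hf.coeFn_toLp, hg.coeFn_toLp] with p h1 h2
  rw [h1, h2, real_inner_eq_re_inner ℝ]
  simp [mul_comm]

theorem memLp_sphHarmC (α : ℕ × ℕ × ℤ) : MemLp (sphHarmC α) 2 sphMeasure :=
  (sphHarmC α).continuous.memLp_of_hasCompactSupport (HasCompactSupport.of_compactSpace _)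

/-- The spherical harmonics, in `L²` of the sphere. -/
def harmLp (α : {α // memLam α}) : Lp ℝ 2 sphMeasure :=
  (memLp_sphHarmC α).toLp (sphHarmC α)

theorem orthonormal_harmLp : Orthonormal ℝ harmLp := by
  classical
  rw [orthonormal_iff_ite]
  intro α β
  rw [harmLp, harmLp, inner_toLp_sphMeasure]
  simp only [Subtype.ext_iff]
  exact integral_sphHarm_mul α.2 β.2

theorem top_le_closure_span_harmLp :
    ⊤ ≤ (Submodule.span ℝ (Set.range harmLp)).topologicalClosure := by
  have h := (ContinuousMap.toLp_denseRange ℝ sphMeasure ℝ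
    (p := 2) (by norm_num)).topologicalClosure_map_submodule harmSpan_dense
  rw [harmSpan, Submodule.map_span, ← Set.range_comp] at h
  exact h.ge

theorem cfac_cube_mul_div_sqrt (x : E3) (a b : ℝ) :
    cfac x ^ 3 * (a / √(cfac x) * (b / √(cfac x))) = cfac x ^ 2 * (a * b) := by
  have h0 := Real.sqrt_pos.mpr (cfac_pos x)
  have h1 := Real.sq_sqrt (cfac_pos x).le
  field_simp
  rw [h1]
  ring

theorem sphHarmC_stereoS (α : {α // memLam α}) (x : E3) :
    sphHarmC α (stereoS x) = Wfun α x / √(cfac x) := by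
  have h0 := Real.sqrt_pos.mpr (cfac_pos x)
  rw [Wfun_eq α.2, mul_div_cancel_left₀ _ h0.ne']
  rfl

theorem hasSum_integral_mul {u v : E3 → ℝ} (hu : AEStronglyMeasurable u)
    (hv : AEStronglyMeasurable v) (hu2 : Integrable fun x => cfac x ^ 2 * u x ^ 2)
    (hv2 : Integrable fun x => cfac x ^ 2 * v x ^ 2) :
    HasSum (fun α : {α // memLam α} => (∫ x, cfac x ^ 2 * (u x * Wfun α x)) *
      ∫ x, cfac x ^ 2 * (Wfun α x * v x)) (∫ x, cfac x ^ 2 * (u x * v x)) := by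
  have h := (HilbertBasis.mk orthonormal_harmLp top_le_closure_span_harmLp).hasSum_inner_mul_inner
    ((memLp_toSphere hu hu2).toLp _) ((memLp_toSphere hv hv2).toLp _)
  simpa only [HilbertBasis.coe_mk, harmLp, inner_toLp_sphMeasure, toSphere_stereoS,
    sphHarmC_stereoS, cfac_cube_mul_div_sqrt] using h

/-! ### Convergence of the expansion in the energy space -/

theorem inner_toLp_volume {F H : E3 → E3} (hF : MemLp F 2 volume) (hH : MemLp H 2 volume) :
    ⟪hF.toLp F, hH.toLp H⟫ = ∫ x, ⟪F x, H x⟫ := by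
  rw [L2.inner_def]
  refine integral_congr_ae ?_
  filter_upwards [hF.coeFn_toLp, hH.coeFn_toLp] with x h1 h2
  rw [h1, h2]

/-- The gradient of `Wfun α`, in `L²`. -/
def gradLp (α : {α // memLam α}) : Lp E3 2 (volume : Measure E3) :=
  (memLp_gradient_Wfun α.2).toLp _

theorem orthonormal_gradLp : Orthonormal ℝ fun α => (√(eigval α.1.1))⁻¹ • gradLp α := by
  classical
  rw [orthonormal_iff_ite]
  intro α β
  rw [real_inner_smul_left, real_inner_smul_right, gradLp, gradLp, inner_toLp_volume,
    integral_inner_gradient_Wfun α.2 β.2]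
  by_cases h : α = β
  · subst h
    have h0 := Real.sqrt_pos.mpr (eigval_pos α.1.1)
    have h1 := Real.sq_sqrt (eigval_pos α.1.1).le
    rw [if_pos rfl, if_pos rfl]
    field_simp
    exact h1.symm
  · rw [if_neg h, if_neg fun h' => h (Subtype.ext h')]
    simp

theorem summable_gradLp (g : Lp E3 2 (volume : Measure E3)) :
    Summable fun α => ((eigval α.1.1)⁻¹ * ⟪g, gradLp α⟫) • gradLp α := by
  have h := (orthonormal_gradLp.orthogonalFamily.summable_iff_norm_sq_summable
    fun α => ⟪(√(eigval α.1.1))⁻¹ • gradLp α, g⟫).mpr (orthonormal_gradLp.inner_products_summable g)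
  refine h.congr fun α => ?_
  have h1 : (√(eigval α.1.1))⁻¹ * (√(eigval α.1.1))⁻¹ = (eigval α.1.1)⁻¹ := by
    rw [← mul_inv, Real.mul_self_sqrt (eigval_pos _).le]
  rw [LinearIsometry.toSpanSingleton_apply, smul_smul, real_inner_smul_left, real_inner_comm, ← h1]
  congr 1
  ring

theorem HasCompactSupport.memLp_smul_single {φ : E3 → ℝ} (hc : HasCompactSupport φ)
    (hφ : Continuous φ) (i : Fin 3) :
    MemLp (fun x => φ x • (EuclideanSpace.single i 1 : E3)) 2 volume :=
  (hφ.smul continuous_const).memLp_of_hasCompactSupport hc.smul_right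

theorem inner_toLp_smul_single {F : E3 → E3} (hF : MemLp F 2 volume) {φ : E3 → ℝ}
    (hc : HasCompactSupport φ) (hφ : Continuous φ) (i : Fin 3) :
    ⟪hF.toLp F, (hc.memLp_smul_single hφ i).toLp _⟫ = ∫ x, F x i * φ x := by
  rw [inner_toLp_volume]
  refine integral_congr_ae (Eventually.of_forall fun x => ?_)
  simp [real_inner_smul_right, EuclideanSpace.inner_single_right, mul_comm]

theorem toLp_eq_zero_of_test {D : Lp E3 2 (volume : Measure E3)}
    (h : ∀ φ : E3 → ℝ, ContDiff ℝ (⊤ : ℕ∞) φ → HasCompactSupport φ → ∀ i,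
      ∫ x, D x i * φ x = 0) : D = 0 := by
  have hloc : LocallyIntegrable D volume := (Lp.memLp D).locallyIntegrable one_le_two
  rw [Lp.eq_zero_iff_ae_eq_zero]
  refine ae_eq_zero_of_integral_contDiff_smul_eq_zero hloc fun φ hφ hc => ?_
  have hintg : Integrable fun x => φ x • D x :=
    hloc.integrable_smul_left_of_hasCompactSupport hφ.continuous hc
  ext i
  have h1 := integral_inner (𝕜 := ℝ) hintg (EuclideanSpace.single i 1)
  simp only [EuclideanSpace.inner_single_left, PiLp.smul_apply, smul_eq_mul, map_one,
    one_mul] at h1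
  rw [← h1, PiLp.zero_apply, ← h φ hφ hc i]
  simp only [mul_comm]

/-- The expansion of a function of the energy space converges weakly, as distributions. -/
theorem MemW10.hasSum_test {U : E3 → ℝ} {G : E3 → E3} (h : MemW10 U G) {φ : E3 → ℝ}
    (hφ : ContDiff ℝ (⊤ : ℕ∞) φ) (hc : HasCompactSupport φ) (i : Fin 3) :
    HasSum (fun α : {α // memLam α} => ((eigval α.1.1)⁻¹ * ∫ x, ⟪G x, gradient (Wfun α) x⟫) *
      ∫ x, gradient (Wfun α) x i * φ x) (∫ x, G x i * φ x) := by
  have hd : Continuous (pd3 i φ) := (contDiff_pd3 hφ i).continuous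
  have hdc : HasCompactSupport (pd3 i φ) := by
    refine (hc.fderiv ℝ).mono fun x hx hx' => hx ?_
    simp [pd3, hx']
  have hv : Continuous fun x => pd3 i φ x / cfac x ^ 2 :=
    hd.div (continuous_cfac.pow 2) fun x => pow_ne_zero 2 (cfac_pos x).ne'
  have hcancel : ∀ (x : E3) (a : ℝ), cfac x ^ 2 * (a * (pd3 i φ x / cfac x ^ 2)) = a * pd3 i φ x := by
    intro x a
    have := cfac_pos x
    field_simp
  have hU2 : Integrable fun x => cfac x ^ 2 * U x ^ 2 := by
    refine (h.integrable_sq_mul_cfac.const_mul 2).mono'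
      ((continuous_cfac.pow 2).aestronglyMeasurable.mul (h.aestronglyMeasurable.pow 2))
      (Eventually.of_forall fun x => ?_)
    have h0 := cfac_pos x
    rw [Real.norm_of_nonneg (by positivity)]
    nlinarith [mul_nonneg (mul_nonneg h0.le (sq_nonneg (U x))) (sub_nonneg.mpr (cfac_le_two x))]
  have hv2 : Integrable fun x => cfac x ^ 2 * (pd3 i φ x / cfac x ^ 2) ^ 2 := by
    refine Continuous.integrable_of_hasCompactSupport
      ((continuous_cfac.pow 2).mul (hv.pow 2)) (hdc.mono fun x hx hx' => hx ?_)
    simp [hx']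
  have hsum := (hasSum_integral_mul h.aestronglyMeasurable hv.aestronglyMeasurable hU2 hv2).neg
  simp only [hcancel] at hsum
  rw [h.2.2.2.1 φ hφ hc i, neg_neg] at hsum
  refine hsum.congr_fun fun α => ?_
  rw [isWeakGradient_Wfun α.2 φ hφ hc i, h.green α.2,
    inv_mul_cancel_left₀ (eigval_pos α.1.1).ne']
  ring

theorem MemW10.hasSum_gradLp {U : E3 → ℝ} {G : E3 → E3} (h : MemW10 U G) :
    HasSum (fun α : {α // memLam α} =>
      ((eigval α.1.1)⁻¹ * ∫ x, ⟪G x, gradient (Wfun α) x⟫) • gradLp α) (h.memLp.toLp G) := by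
  set g := h.memLp.toLp G
  have hg : ∀ α : {α // memLam α}, ⟪g, gradLp α⟫ = ∫ x, ⟪G x, gradient (Wfun α) x⟫ :=
    fun α => inner_toLp_volume _ _
  obtain ⟨H, hH⟩ := summable_gradLp g
  simp only [hg] at hH
  suffices hD : H - g = 0 by rwa [sub_eq_zero.mp hD] at hH
  refine toLp_eq_zero_of_test fun φ hφ hc i => ?_
  have h1 := hH.mapL (innerSL ℝ ((hc.memLp_smul_single hφ.continuous i).toLp _))
  simp only [innerSL_apply_apply, real_inner_smul_right] at h1
  have h2 : ∀ α, ⟪(hc.memLp_smul_single hφ.continuous i).toLp _, gradLp α⟫ =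
      ∫ x, gradient (Wfun α) x i * φ x := fun α => by
    rw [real_inner_comm]
    exact inner_toLp_smul_single _ hc hφ.continuous i
  simp only [h2] at h1
  have h3 := h1.unique (h.hasSum_test hφ hc i)
  rw [← inner_toLp_smul_single (Lp.memLp (H - g)) hc hφ.continuous i, Lp.toLp_coeFn, inner_sub_left,
    inner_toLp_smul_single h.memLp hc hφ.continuous i, real_inner_comm, h3, sub_self]

theorem mem_LamStar {N : ℕ} {α : ℕ × ℕ × ℤ} : α ∈ LamStar N ↔ memLam α ∧ α.1 ≤ N := by
  obtain ⟨k, l, m⟩ := α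
  simp only [LamStar, LamK, memLam, Finset.mem_biUnion, Finset.mem_range, Finset.mem_image,
    Finset.mem_Icc, Prod.mk.injEq]
  constructor
  · rintro ⟨k', hk', l', hl', m', hm', rfl, rfl, rfl⟩
    omega
  · rintro ⟨⟨h1, h2⟩, h3⟩
    exact ⟨k, by omega, l, by omega, m, by omega, rfl, rfl, rfl⟩

instance : DecidablePred memLam := fun _ => inferInstanceAs (Decidable (_ ∧ _))

theorem tendsto_LamStar :
    Tendsto (fun N => (LamStar N).subtype memLam) atTop atTop := by
  refine tendsto_atTop_finset_of_monotone (fun M N hMN α hα => ?_) fun α => ⟨α.1.1, ?_⟩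
  · simp only [Finset.mem_subtype, mem_LamStar] at hα ⊢
    exact ⟨hα.1, hα.2.trans hMN⟩
  · simp only [Finset.mem_subtype, mem_LamStar]
    exact ⟨α.2, le_rfl⟩

theorem norm_sum_gradLp_sub_sq (s : Finset {α // memLam α}) (c : {α // memLam α} → ℝ)
    {G : E3 → E3} (hG : MemLp G 2 volume) :
    ‖∑ α ∈ s, c α • gradLp α - hG.toLp G‖ ^ 2 =
      ∫ x, ‖∑ α ∈ s, c α • gradient (Wfun α) x - G x‖ ^ 2 := by
  have hae : ∀ s : Finset {α // memLam α}, ⇑(∑ α ∈ s, c α • gradLp α) =ᵐ[volume]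
      fun x => ∑ α ∈ s, c α • gradient (Wfun α) x := by
    classical
    intro s
    induction s using Finset.induction_on with
    | empty => simpa using! Lp.coeFn_zero E3 2 volume
    | insert α s hα ih =>
      rw [Finset.sum_insert hα]
      filter_upwards [Lp.coeFn_add (c α • gradLp α) (∑ α ∈ s, c α • gradLp α), ih,
        Lp.coeFn_smul (c α) (gradLp α), (memLp_gradient_Wfun α.2).coeFn_toLp] with x h1 h2 h3 h4
      rw [h1, Pi.add_apply, h2, h3, Pi.smul_apply, Finset.sum_insert hα]
      exact congrArg (fun v => c α • v + _) h4
  rw [← real_inner_self_eq_norm_sq, L2.inner_def]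
  refine integral_congr_ae ?_
  filter_upwards [hae s, hG.coeFn_toLp,
    Lp.coeFn_sub (∑ α ∈ s, c α • gradLp α) (hG.toLp G)] with x h1 h2 h3
  rw [h3, Pi.sub_apply, h1, h2, real_inner_self_eq_norm_sq]

/-- The family `(𝒲_α)_{α∈Λ}` is (after normalization) a Hilbert basis of
`W¹₀(ℝ³)` for the inner product `((v,w)) = ∫∇v·∇w`: the `𝒲_α` are pairwise orthogonal,
have nonzero norm, and every `U ∈ W¹₀(ℝ³)` is the sum of its expansion
`U = Σ_k (4/((2k+1)(2k+3))) Σ_{α∈Λ_k} (∫∇U·∇𝒲_α dx) 𝒲_α`, convergent in `W¹₀(ℝ³)`. -/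
theorem AB_hilbert_basis :
    (∀ α β : ℕ × ℕ × ℤ, memLam α → memLam β → α ≠ β →
      (∫ x : E3, ⟪gradient (Wfun α) x, gradient (Wfun β) x⟫) = 0) ∧
    (∀ α : ℕ × ℕ × ℤ, memLam α → (∫ x : E3, ‖gradient (Wfun α) x‖^2) ≠ 0) ∧
    (∀ (U : E3 → ℝ) (G : E3 → E3), MemW10 U G →
      Tendsto (fun N : ℕ => ∫ x : E3,
          ‖(∑ α ∈ LamStar N,
              ((4 / ((2*(α.1:ℝ)+1)*(2*(α.1:ℝ)+3))) *
                ∫ y : E3, ⟪G y, gradient (Wfun α) y⟫) • gradient (Wfun α) x) - G x‖^2)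
        atTop (nhds 0)) := by
  refine ⟨fun α β hα hβ hne => ?_, fun α hα => ?_, fun U G h => ?_⟩
  · rw [integral_inner_gradient_Wfun hα hβ, if_neg hne]
  · simp only [← real_inner_self_eq_norm_sq]
    rw [integral_inner_gradient_Wfun hα hα, if_pos rfl]
    exact (eigval_pos α.1).ne'
  · have hsum : Tendsto _ _ _ := h.hasSum_gradLp
    have ht := ((hsum.comp tendsto_LamStar).sub_const (h.memLp.toLp G)).norm.pow 2
    simp only [sub_self, norm_zero, ne_eq, OfNat.ofNat_ne_zero, not_false_eq_true, zero_pow,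
      Function.comp_apply, norm_sum_gradLp_sub_sq] at ht
    refine ht.congr fun N => integral_congr_ae (Eventually.of_forall fun x => ?_)
    simp only
    rw [Finset.sum_subtype_of_mem (fun α : ℕ × ℕ × ℤ => ((eigval α.1)⁻¹ *
      ∫ y, ⟪G y, gradient (Wfun α) y⟫) • gradient (Wfun α) x) fun α hα => (mem_LamStar.mp hα).1]
    simp only [eigval, inv_div]

end
end

section
/- For every integer N ≥ 0, the real vector space H_N has dimension C(N+3,3) + C(N+2,3) = (N+1)(N+2)(2N+3)/6, where C(n,r) denotes the binomial coefficient. -/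
open MeasureTheory Real Filter Metric
open scoped RealInnerProductSpace BigOperators

noncomputable section

/-- Membership in `H_N`: `v(x) = Σ_{k=0}^N p_k(x)/(|x|²+1)^{k+1/2}` with `deg p_k ≤ k`. -/
def memHN (N : ℕ) (v : E3 → ℝ) : Prop :=
  ∃ p : ℕ → MvPolynomial (Fin 3) ℝ,
    (∀ k, k ≤ N → (p k).totalDegree ≤ k) ∧
    ∀ x : E3, v x = ∑ k ∈ Finset.range (N+1),
      (MvPolynomial.eval (fun j => x j) (p k)) / (‖x‖^2+1) ^ ((k:ℝ) + 1/2)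

/-- The space `H_N`, as a submodule of the real functions on `ℝ³`. -/
def HNspace (N : ℕ) : Submodule ℝ (E3 → ℝ) := Submodule.span ℝ {v | memHN N v}

open MvPolynomial in
theorem finrank_restrictTotalDegree (σ K : Type*) [Fintype σ] [Field K] (m : ℕ) :
    Module.finrank K (restrictTotalDegree σ K m) = (Fintype.card σ + 1).multichoose m := by
  classical
  have hset : {n : σ →₀ ℕ | n.degree ≤ m} =
      (((Finset.range (m + 1)).biUnion fun j => Finset.finsuppAntidiag Finset.univ j :
        Finset (σ →₀ ℕ)) : Set (σ →₀ ℕ)) := by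
    ext n
    simp [Finsupp.degree_eq_sum]
  have hcard : ∀ m : ℕ, ∑ j ∈ Finset.range (m + 1), (Fintype.card σ).multichoose j =
      (Fintype.card σ + 1).multichoose m := by
    intro m
    induction m with
    | zero => simp
    | succ m ih => rw [Finset.sum_range_succ, ih, Nat.multichoose_succ_succ, add_comm]
  have hb := Module.finrank_eq_nat_card_basis
    (basisRestrictSupport K {n : σ →₀ ℕ | n.degree ≤ m})
  change Module.finrank K (restrictSupport K {n : σ →₀ ℕ | n.degree ≤ m}) = _
  rw [hb, Nat.card_coe_set_eq, hset, Set.ncard_coe_finset, Finset.card_biUnion, ← hcard]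
  · simp [Finset.card_finsuppAntidiag_nat_eq_multichoose]
  · intro i _ j _ hij
    rw [Function.onFun, Finset.disjoint_left]
    intro n hi hj
    simp only [Finset.mem_finsuppAntidiag] at hi hj
    exact hij (hi.1.symm.trans hj.1)

/-- The polynomial `|x|² + 1` in three variables. -/
def normSqAddOne : MvPolynomial (Fin 3) ℝ := ∑ i, MvPolynomial.X i ^ 2 + 1

theorem eval_normSqAddOne (x : E3) :
    MvPolynomial.eval (fun j => x j) normSqAddOne = ‖x‖ ^ 2 + 1 := by
  simp [normSqAddOne, EuclideanSpace.norm_sq_eq]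

open MvPolynomial in
theorem coeff_normSqAddOne : coeff (Finsupp.single 0 2) normSqAddOne = 1 := by
  simp [normSqAddOne, Fin.sum_univ_three, coeff_X_pow, coeff_one, Finsupp.single_left_inj,
    eq_comm (a := (0 : Fin 3 →₀ ℕ))]

theorem normSqAddOne_ne_zero : normSqAddOne ≠ 0 := by
  intro h
  simpa [h] using coeff_normSqAddOne

open MvPolynomial in
theorem totalDegree_normSqAddOne : normSqAddOne.totalDegree = 2 := by
  apply le_antisymm
  · refine (totalDegree_add _ _).trans (max_le ?_ (by simp))
    exact totalDegree_finsetSum_le fun i _ => (totalDegree_X_pow i 2).le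
  · have h : Finsupp.single 0 2 ∈ normSqAddOne.support := by
      simp [mem_support_iff, coeff_normSqAddOne]
    simpa using le_totalDegree h

theorem totalDegree_normSqAddOne_mul_le_iff {q : MvPolynomial (Fin 3) ℝ} {m : ℕ} :
    (normSqAddOne * q).totalDegree ≤ m + 2 ↔ q.totalDegree ≤ m := by
  rcases eq_or_ne q 0 with rfl | hq
  · simp
  · rw [MvPolynomial.totalDegree_mul_of_isDomain normSqAddOne_ne_zero hq,
      totalDegree_normSqAddOne]
    omega

theorem mulLeft_normSqAddOne_injective :
    Function.Injective (LinearMap.mulLeft ℝ normSqAddOne) :=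
  mul_right_injective₀ normSqAddOne_ne_zero

/-- The numerators of the elements of `H_N` over the common denominator `(|x|² + 1) ^ (N + 1/2)`. -/
def numerators : ℕ → Submodule ℝ (MvPolynomial (Fin 3) ℝ)
  | 0 => MvPolynomial.restrictTotalDegree (Fin 3) ℝ 0
  | N + 1 => (numerators N).map (LinearMap.mulLeft ℝ normSqAddOne) ⊔
      MvPolynomial.restrictTotalDegree (Fin 3) ℝ (N + 1)

theorem restrictTotalDegree_le_numerators (N : ℕ) :
    MvPolynomial.restrictTotalDegree (Fin 3) ℝ N ≤ numerators N := by
  cases N with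
  | zero => exact le_rfl
  | succ N => exact le_sup_right

theorem finiteDimensional_numerators (N : ℕ) : FiniteDimensional ℝ (numerators N) := by
  induction N with
  | zero => rw [numerators]; infer_instance
  | succ N ih => rw [numerators]; infer_instance

theorem map_numerators_zero_inf :
    (numerators 0).map (LinearMap.mulLeft ℝ normSqAddOne) ⊓
      MvPolynomial.restrictTotalDegree (Fin 3) ℝ 1 = ⊥ := by
  rw [eq_bot_iff]
  rintro _ ⟨⟨q, -, rfl⟩, hdeg⟩
  rcases eq_or_ne q 0 with rfl | hq
  · simp
  · rw [SetLike.mem_coe, MvPolynomial.mem_restrictTotalDegree, LinearMap.mulLeft_apply,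
      MvPolynomial.totalDegree_mul_of_isDomain normSqAddOne_ne_zero hq,
      totalDegree_normSqAddOne] at hdeg
    omega

theorem map_numerators_succ_inf (N : ℕ) :
    (numerators (N + 1)).map (LinearMap.mulLeft ℝ normSqAddOne) ⊓
      MvPolynomial.restrictTotalDegree (Fin 3) ℝ (N + 2) =
    (MvPolynomial.restrictTotalDegree (Fin 3) ℝ N).map (LinearMap.mulLeft ℝ normSqAddOne) := by
  apply le_antisymm
  · rintro _ ⟨⟨q, -, rfl⟩, hdeg⟩
    rw [SetLike.mem_coe, MvPolynomial.mem_restrictTotalDegree, LinearMap.mulLeft_apply,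
      totalDegree_normSqAddOne_mul_le_iff] at hdeg
    exact ⟨q, (MvPolynomial.mem_restrictTotalDegree _ _ _).2 hdeg, rfl⟩
  · rintro _ ⟨q, hq, rfl⟩
    rw [SetLike.mem_coe, MvPolynomial.mem_restrictTotalDegree] at hq
    refine ⟨⟨q, restrictTotalDegree_le_numerators _ ?_, rfl⟩, ?_⟩
    · rw [MvPolynomial.mem_restrictTotalDegree]
      omega
    · rw [SetLike.mem_coe, MvPolynomial.mem_restrictTotalDegree, LinearMap.mulLeft_apply]
      exact totalDegree_normSqAddOne_mul_le_iff.2 hq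

theorem finrank_restrictTotalDegree_fin_three (m : ℕ) :
    Module.finrank ℝ (MvPolynomial.restrictTotalDegree (Fin 3) ℝ m) = (m + 3).choose 3 := by
  rw [finrank_restrictTotalDegree, Nat.multichoose_eq, Fintype.card_fin,
    show 3 + 1 + m - 1 = m + 3 by omega, Nat.choose_symm_add]

theorem finrank_numerators (N : ℕ) :
    Module.finrank ℝ (numerators N) = (N + 3).choose 3 + (N + 2).choose 3 := by
  induction N with
  | zero => exact finrank_restrictTotalDegree_fin_three 0
  | succ N ih =>
    have := finiteDimensional_numerators N
    have h := Submodule.finrank_sup_add_finrank_inf_eq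
      ((numerators N).map (LinearMap.mulLeft ℝ normSqAddOne))
      (MvPolynomial.restrictTotalDegree (Fin 3) ℝ (N + 1))
    rw [(LinearEquiv.finrank_eq (Submodule.equivMapOfInjective _
      mulLeft_normSqAddOne_injective _)).symm, ih, finrank_restrictTotalDegree_fin_three] at h
    change Module.finrank ℝ (numerators (N + 1)) + _ = _ at h
    cases N with
    | zero =>
      rw [map_numerators_zero_inf, finrank_bot] at h
      simpa [Nat.choose] using h
    | succ N =>
      rw [map_numerators_succ_inf, (LinearEquiv.finrank_eq (Submodule.equivMapOfInjective _
        mulLeft_normSqAddOne_injective _)).symm, finrank_restrictTotalDegree_fin_three] at h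
      simp only [Nat.add_assoc, Nat.reduceAdd] at h ⊢
      omega

/-- Division by `(|x|² + 1) ^ (N + 1/2)`, from polynomials to functions. -/
def divNormSqAddOne (N : ℕ) : MvPolynomial (Fin 3) ℝ →ₗ[ℝ] (E3 → ℝ) where
  toFun q x := MvPolynomial.eval (fun j => x j) q / (‖x‖ ^ 2 + 1) ^ ((N : ℝ) + 1 / 2)
  map_add' p q := by
    ext x
    simp [add_div]
  map_smul' c p := by
    ext x
    simp [mul_div_assoc]

theorem divNormSqAddOne_injective (N : ℕ) : Function.Injective (divNormSqAddOne N) := by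
  intro p q h
  refine MvPolynomial.funext fun x => ?_
  have hx := congrFun h (WithLp.toLp 2 x)
  have hpos : (0 : ℝ) < (‖(WithLp.toLp 2 x : E3)‖ ^ 2 + 1) ^ ((N : ℝ) + 1 / 2) := by positivity
  exact (div_left_inj' hpos.ne').1 hx

theorem divNormSqAddOne_succ_mul (N : ℕ) (q : MvPolynomial (Fin 3) ℝ) :
    divNormSqAddOne (N + 1) (normSqAddOne * q) = divNormSqAddOne N q := by
  ext x
  have hpos : (0 : ℝ) < ‖x‖ ^ 2 + 1 := by positivity
  simp only [divNormSqAddOne, LinearMap.coe_mk, AddHom.coe_mk, map_mul, eval_normSqAddOne]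
  rw [show ((N + 1 : ℕ) : ℝ) + 1 / 2 = 1 + ((N : ℝ) + 1 / 2) by push_cast; ring,
    rpow_add hpos, rpow_one, mul_div_mul_left _ _ hpos.ne']

theorem memHN_succ_iff {N : ℕ} {v : E3 → ℝ} :
    memHN (N + 1) v ↔ ∃ u, memHN N u ∧
      ∃ q : MvPolynomial (Fin 3) ℝ, q.totalDegree ≤ N + 1 ∧ v = u + divNormSqAddOne (N + 1) q := by
  constructor
  · rintro ⟨p, hp, hv⟩
    refine ⟨_, ⟨p, fun k hk => hp k (by omega), fun x => rfl⟩, p (N + 1), hp _ le_rfl, ?_⟩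
    ext x
    rw [hv, Finset.sum_range_succ]
    rfl
  · rintro ⟨u, ⟨p, hp, hu⟩, q, hq, rfl⟩
    refine ⟨Function.update p (N + 1) q, fun k hk => ?_, fun x => ?_⟩
    · rcases eq_or_ne k (N + 1) with rfl | hne
      · simpa using hq
      · rw [Function.update_of_ne hne]
        exact hp k (by omega)
    · rw [Finset.sum_range_succ, Function.update_self, Pi.add_apply, hu]
      refine congrArg₂ (· + ·) (Finset.sum_congr rfl fun k hk => ?_) rfl
      rw [Function.update_of_ne (Finset.mem_range.1 hk).ne]

theorem memHN_iff {N : ℕ} {v : E3 → ℝ} :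
    memHN N v ↔ v ∈ (numerators N).map (divNormSqAddOne N) := by
  induction N generalizing v with
  | zero =>
    constructor
    · rintro ⟨p, hp, hv⟩
      refine ⟨p 0, (MvPolynomial.mem_restrictTotalDegree _ _ _).2 (hp 0 le_rfl), ?_⟩
      ext x
      simp [hv, divNormSqAddOne]
    · rintro ⟨q, hq, rfl⟩
      refine ⟨fun _ => q, fun k _ => ?_, fun x => by simp [divNormSqAddOne]⟩
      exact ((MvPolynomial.mem_restrictTotalDegree _ _ _).1 hq).trans k.zero_le
  | succ N ih =>
    simp only [memHN_succ_iff, ih, numerators, Submodule.map_sup, Submodule.mem_sup,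
      Submodule.mem_map, MvPolynomial.mem_restrictTotalDegree]
    constructor
    · rintro ⟨_, ⟨r, hr, rfl⟩, q, hq, rfl⟩
      exact ⟨_, ⟨_, ⟨r, hr, rfl⟩, divNormSqAddOne_succ_mul N r⟩, _, ⟨q, hq, rfl⟩, rfl⟩
    · rintro ⟨_, ⟨_, ⟨r, hr, rfl⟩, rfl⟩, _, ⟨q, hq, rfl⟩, rfl⟩
      refine ⟨_, ⟨r, hr, rfl⟩, q, hq, ?_⟩
      rw [LinearMap.mulLeft_apply, divNormSqAddOne_succ_mul]

theorem HNspace_eq_map_numerators (N : ℕ) :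
    HNspace N = (numerators N).map (divNormSqAddOne N) := by
  have h : {v | memHN N v} = ((numerators N).map (divNormSqAddOne N) : Set (E3 → ℝ)) :=
    Set.ext fun v => memHN_iff
  rw [HNspace, h, Submodule.span_eq]

theorem six_mul_choose_three_add (N : ℕ) :
    6 * ((N + 3).choose 3 + (N + 2).choose 3) = (N + 1) * (N + 2) * (2 * N + 3) := by
  have h (n : ℕ) : 6 * (n + 2).choose 3 = (n + 2) * (n + 1) * n := by
    have := Nat.descFactorial_eq_factorial_mul_choose (n + 2) 3
    simp only [Nat.descFactorial, Nat.factorial] at this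
    have h₁ : n + 2 - 2 = n := by omega
    have h₂ : n + 2 - 1 = n + 1 := by omega
    rw [h₁, h₂] at this
    simp only [Nat.sub_zero, Nat.succ_eq_add_one] at this
    linarith
  have h₁ := h N
  have h₂ := h (N + 1)
  rw [show N + 1 + 2 = N + 3 by omega] at h₂
  rw [mul_add, h₁, h₂]
  ring

/-- `dim H_N = C(N+3,3) + C(N+2,3) = (N+1)(N+2)(2N+3)/6`. -/
theorem HN_finrank (N : ℕ) :
    Module.finrank ℝ (HNspace N) = Nat.choose (N+3) 3 + Nat.choose (N+2) 3 ∧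
    Module.finrank ℝ (HNspace N) = (N+1)*(N+2)*(2*N+3)/6 := by
  have h : Module.finrank ℝ (HNspace N) = Nat.choose (N + 3) 3 + Nat.choose (N + 2) 3 := by
    rw [HNspace_eq_map_numerators, ← finrank_numerators]
    exact (LinearEquiv.finrank_eq (Submodule.equivMapOfInjective _
      (divNormSqAddOne_injective N) _)).symm
  refine ⟨h, ?_⟩
  rw [h, ← six_mul_choose_three_add]
  omega

end
end
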